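/- arXiv:1803.10798 — 3 statements merged into one kernel-verified Lean document; each statement's English description precedes it below -/
import Mathlib

section
/- For every τ in the upper half-plane, η(τ/2)^{8}/η(2τ)^{8} − η(τ)^{24}/(η(τ/2)^{8} η(2τ)^{16}) = −16. (This is the identity underlying the Conway moonshine trace functions for the class 2B of Co₀, with Frame shape 1⁸2⁸; equivalently it expresses that F^{2B}_{0,1} is the constant −8 and F^{2B}_{1,1}(τ) = η(τ/2)^8/η(2τ)^8 + 8.) -/
open scoped Real

/-- The Dedekind eta function `η(τ) = e^{πiτ/12} ∏_{n=1}^∞ (1 - e^{2πinτ})`. -/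
noncomputable def eta (τ : ℂ) : ℂ :=
  Complex.exp (Real.pi * Complex.I * τ / 12) *
    ∏' n : ℕ, (1 - Complex.exp (2 * Real.pi * Complex.I * (n + 1) * τ))

open Filter Topology

lemma aux_summable (q z : ℂ) (hq0 : q ≠ 0) (hq : ‖q‖ < 1) (hz : z ≠ 0) :
    Summable fun j : ℤ => ‖q ^ (j ^ 2) * z ^ j‖ := by
  have hpi : (Real.pi : ℂ) ≠ 0 := by exact_mod_cast Real.pi_ne_zero
  have h := (summable_jacobiTheta₂_term_iff (Complex.log z / (2 * Real.pi * Complex.I))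
    (Complex.log q / (Real.pi * Complex.I))).2 (by
      have : Complex.log q / (Real.pi * Complex.I)
          = ((1 / Real.pi : ℝ) : ℂ) * (Complex.log q * (-Complex.I)) := by
        push_cast
        field_simp
        simp
      rw [this, Complex.im_ofReal_mul]
      have hl : Real.log ‖q‖ < 0 := Real.log_neg (norm_pos_iff.2 hq0) hq
      have : (Complex.log q * (-Complex.I)).im = - Real.log ‖q‖ := by
        simp [Complex.log_re]
      rw [this]
      exact mul_pos (by positivity) (by linarith))
  refine (h.norm).congr fun j => ?_
  congr 1
  unfold jacobiTheta₂_term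
  rw [show 2 * (Real.pi : ℂ) * Complex.I * j * (Complex.log z / (2 * Real.pi * Complex.I))
    + Real.pi * Complex.I * j ^ 2 * (Complex.log q / (Real.pi * Complex.I))
    = ((j ^ 2 : ℤ) : ℂ) * Complex.log q + (j : ℂ) * Complex.log z by
      push_cast; field_simp; ring]
  rw [Complex.exp_add, Complex.exp_int_mul, Complex.exp_int_mul, Complex.exp_log hq0,
    Complex.exp_log hz]

lemma aux_split (f : ℤ × ℤ → ℂ) (hf : Summable f) :
    ∑' p, f p = ∑' p : ℤ × ℤ, f (p.1 + p.2, p.1 - p.2)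
      + ∑' p : ℤ × ℤ, f (p.1 + p.2 + 1, p.1 - p.2) := by
  let φ : ℤ × ℤ → ℤ × ℤ := fun p => (p.1 + p.2, p.1 - p.2)
  let ψ : ℤ × ℤ → ℤ × ℤ := fun p => (p.1 + p.2 + 1, p.1 - p.2)
  have hφ : Function.Injective φ := by
    rintro ⟨a, b⟩ ⟨c, d⟩ h
    simp only [φ, Prod.mk.injEq] at h ⊢
    omega
  have hψ : Function.Injective ψ := by
    rintro ⟨a, b⟩ ⟨c, d⟩ h
    simp only [ψ, Prod.mk.injEq] at h ⊢
    omega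
  have hc : IsCompl (Set.range φ) (Set.range ψ) := by
    rw [isCompl_iff, Set.disjoint_iff, codisjoint_iff_le_sup]
    constructor
    · rintro _ ⟨⟨⟨a, b⟩, rfl⟩, ⟨⟨c, d⟩, h⟩⟩
      simp only [φ, ψ, Prod.mk.injEq] at h
      omega
    · rintro ⟨m, n⟩ -
      rcases Int.even_or_odd (m + n) with h | h
      · left
        obtain ⟨k, hk⟩ := h
        exact ⟨(k, m - k), by simp only [φ, Prod.mk.injEq]; omega⟩
      · right
        obtain ⟨k, hk⟩ := h
        exact ⟨(k, m - k - 1), by simp only [ψ, Prod.mk.injEq]; omega⟩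
  have h1 := (hf.comp_injective hφ).hasSum
  have h2 := (hf.comp_injective hψ).hasSum
  exact (HasSum.add_isCompl hc (hφ.hasSum_range_iff.2 h1) (hψ.hasSum_range_iff.2 h2)).tsum_eq

noncomputable def T3 (q : ℂ) : ℂ := ∑' j : ℤ, q ^ (j ^ 2)
noncomputable def T2 (q : ℂ) : ℂ := ∑' j : ℤ, q ^ (j ^ 2 + j)

lemma sum3 (q : ℂ) (hq0 : q ≠ 0) (hq : ‖q‖ < 1) : Summable fun j : ℤ => ‖q ^ (j ^ 2)‖ := by
  simpa using aux_summable q 1 hq0 hq one_ne_zero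

lemma sum2 (q : ℂ) (hq0 : q ≠ 0) (hq : ‖q‖ < 1) : Summable fun j : ℤ => ‖q ^ (j ^ 2 + j)‖ := by
  simpa only [zpow_add₀ hq0] using aux_summable q q hq0 hq hq0

lemma neg_sq_zpow (q : ℂ) (j : ℤ) : (-q) ^ (j ^ 2) = (-1) ^ j * q ^ (j ^ 2) := by
  rw [neg_eq_neg_one_mul, mul_zpow]
  congr 1
  rcases Int.even_or_odd j with h | h
  · rw [h.neg_one_zpow, Even.neg_one_zpow (h.pow_of_ne_zero two_ne_zero)]
  · rw [h.neg_one_zpow, Odd.neg_one_zpow h.pow]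

lemma T3_split (q : ℂ) (hq0 : q ≠ 0) (hq : ‖q‖ < 1) :
    T3 q ^ 2 = T3 (q ^ 2) ^ 2 + q * T2 (q ^ 2) ^ 2 := by
  have hq2 : ‖q ^ 2‖ < 1 := by
    rw [norm_pow]; exact pow_lt_one₀ (norm_nonneg _) hq two_ne_zero
  have hq20 : q ^ 2 ≠ 0 := pow_ne_zero _ hq0
  have s := sum3 q hq0 hq
  have s3 := sum3 _ hq20 hq2
  have s2 := sum2 _ hq20 hq2
  rw [sq (T3 q), sq (T3 (q ^ 2)), sq (T2 (q ^ 2))]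
  unfold T3 T2
  rw [tsum_mul_tsum_of_summable_norm s s, tsum_mul_tsum_of_summable_norm s3 s3,
    tsum_mul_tsum_of_summable_norm s2 s2, aux_split _ (summable_mul_of_summable_norm s s),
    ← tsum_mul_left]
  congr 1
  · refine tsum_congr fun p => ?_
    simp only [← zpow_add₀ hq0, ← zpow_natCast, ← zpow_mul]
    congr 1; push_cast; ring
  · refine tsum_congr fun p => ?_
    simp only [← zpow_natCast, ← zpow_mul]
    rw [← zpow_add₀ hq0, ← zpow_add₀ hq0, ← zpow_one_add₀ hq0]
    congr 1; push_cast; ring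

lemma T2_split (q : ℂ) (hq0 : q ≠ 0) (hq : ‖q‖ < 1) :
    T2 q ^ 2 = 2 * (T2 (q ^ 2) * T3 (q ^ 2)) := by
  have hq2 : ‖q ^ 2‖ < 1 := by
    rw [norm_pow]; exact pow_lt_one₀ (norm_nonneg _) hq two_ne_zero
  have hq20 : q ^ 2 ≠ 0 := pow_ne_zero _ hq0
  have s := sum2 q hq0 hq
  have s3 := sum3 _ hq20 hq2
  have s2 := sum2 _ hq20 hq2
  rw [sq (T2 q), show 2 * (T2 (q ^ 2) * T3 (q ^ 2))
    = T2 (q ^ 2) * T3 (q ^ 2) + T3 (q ^ 2) * T2 (q ^ 2) by ring]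
  unfold T3 T2
  rw [tsum_mul_tsum_of_summable_norm s s, tsum_mul_tsum_of_summable_norm s2 s3,
    tsum_mul_tsum_of_summable_norm s3 s2, aux_split _ (summable_mul_of_summable_norm s s)]
  congr 1
  · refine tsum_congr fun p => ?_
    simp only [← zpow_add₀ hq0, ← zpow_natCast, ← zpow_mul]
    congr 1; push_cast; ring
  · let e : ℤ × ℤ ≃ ℤ × ℤ := (Equiv.addRight 1).prodCongr (Equiv.refl ℤ)
    rw [← e.tsum_eq (fun z : ℤ × ℤ => (q ^ 2) ^ z.1 ^ 2 * (q ^ 2) ^ (z.2 ^ 2 + z.2))]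
    refine tsum_congr fun p => ?_
    simp only [← zpow_add₀ hq0, ← zpow_natCast, ← zpow_mul, e, Equiv.prodCongr_apply, Prod.map,
      Equiv.coe_addRight, Equiv.refl_apply]
    congr 1; push_cast; ring

lemma jacobi_series (q : ℂ) (hq0 : q ≠ 0) (hq : ‖q‖ < 1) :
    T3 q ^ 4 - T3 (-q) ^ 4 = q * T2 q ^ 4 := by
  have h1 := T3_split q hq0 hq
  have h2 := T3_split (-q) (neg_ne_zero.2 hq0) (by rwa [norm_neg])
  have h3 := T2_split q hq0 hq
  rw [neg_sq] at h2
  linear_combination (T3 q ^ 2 + T3 (q ^ 2) ^ 2 + q * T2 (q ^ 2) ^ 2) * h1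
    - (T3 (-q) ^ 2 + T3 (q ^ 2) ^ 2 - q * T2 (q ^ 2) ^ 2) * h2
    - q * (T2 q ^ 2 + 2 * (T2 (q ^ 2) * T3 (q ^ 2))) * h3

/-- finite Pochhammer product -/
noncomputable def poch (Q : ℂ) (n : ℕ) : ℂ := ∏ k ∈ Finset.range n, (1 - Q ^ (k + 1))

/-- reciprocal, extended by zero -/
noncomputable def rp (Q : ℂ) (m : ℤ) : ℂ := if m < 0 then 0 else (poch Q m.toNat)⁻¹

lemma one_sub_pow_ne (Q : ℂ) (hQ : ‖Q‖ < 1) (k : ℕ) : 1 - Q ^ (k + 1) ≠ 0 := by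
  intro h
  have h1 : ‖Q ^ (k + 1)‖ < 1 := by
    rw [norm_pow]; exact pow_lt_one₀ (norm_nonneg _) hQ (by omega)
  rw [← sub_eq_zero.1 h] at h1
  simp at h1

lemma poch_ne (Q : ℂ) (hQ : ‖Q‖ < 1) (n : ℕ) : poch Q n ≠ 0 :=
  Finset.prod_ne_zero_iff.2 fun k _ => one_sub_pow_ne Q hQ k

lemma rp_rec (Q : ℂ) (hQ : ‖Q‖ < 1) (m : ℤ) : rp Q (m - 1) = (1 - Q ^ m) * rp Q m := by
  unfold rp
  rcases lt_trichotomy m 0 with h | h | h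
  · rw [if_pos (by omega), if_pos h, mul_zero]
  · subst h; simp
  · obtain ⟨k, rfl⟩ : ∃ k : ℕ, m = k + 1 := ⟨(m - 1).toNat, by omega⟩
    rw [if_neg (by omega), if_neg (by omega)]
    have h1 : ((k : ℤ) + 1 - 1).toNat = k := by omega
    have h2 : ((k : ℤ) + 1).toNat = k + 1 := by omega
    rw [h1, h2]
    have h3 : poch Q (k + 1) = poch Q k * (1 - Q ^ (k + 1)) := Finset.prod_range_succ _ _
    have := poch_ne Q hQ k
    have := one_sub_pow_ne Q hQ k
    rw [h3, show Q ^ ((k : ℤ) + 1) = Q ^ (k + 1) by exact_mod_cast zpow_natCast Q (k + 1)]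
    field_simp

noncomputable def cf (q : ℂ) (n : ℕ) (j : ℤ) : ℂ :=
  poch (q ^ 2) (2 * n) * rp (q ^ 2) (n + j) * rp (q ^ 2) (n - j)

lemma cf_zero_of (q : ℂ) (n : ℕ) (j : ℤ) (h : j ∉ Finset.Icc (-(n : ℤ)) n) : cf q n j = 0 := by
  have : (n : ℤ) + j < 0 ∨ (n : ℤ) - j < 0 := by
    rw [Finset.mem_Icc] at h; omega
  unfold cf rp
  rcases this with h | h <;> simp [h]

lemma cf_rec (q : ℂ) (hq0 : q ≠ 0) (hq : ‖q‖ < 1) (n : ℕ) (j : ℤ) :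
    cf q (n + 1) j * q ^ (j ^ 2) = (1 + q ^ (4 * n + 2)) * (cf q n j * q ^ (j ^ 2))
      + q ^ (2 * n + 1) * (cf q n (j - 1) * q ^ ((j - 1) ^ 2))
      + q ^ (2 * n + 1) * (cf q n (j + 1) * q ^ ((j + 1) ^ 2)) := by
  have hQ : ‖q ^ 2‖ < 1 := by
    rw [norm_pow]; exact pow_lt_one₀ (norm_nonneg _) hq two_ne_zero
  unfold cf
  have hp : poch (q ^ 2) (2 * (n + 1)) = poch (q ^ 2) (2 * n) * (1 - (q ^ 2) ^ (2 * n + 1))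
      * (1 - (q ^ 2) ^ (2 * n + 2)) := by
    unfold poch
    rw [show 2 * (n + 1) = 2 * n + 1 + 1 by ring, Finset.prod_range_succ, Finset.prod_range_succ]
  have r := rp_rec (q ^ 2) hQ
  have a1 := r (n + 1 + j)
  have a2 := r (n + j)
  have b1 := r (n + 1 - j)
  have b2 := r (n - j)
  rw [show (n : ℤ) + 1 + j - 1 = n + j by ring] at a1
  rw [show (n : ℤ) + 1 - j - 1 = n - j by ring] at b1
  rw [hp, show (n : ℤ) + (j - 1) = n + j - 1 by ring, show (n : ℤ) - (j - 1) = n + 1 - j by ring,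
    show (n : ℤ) + (j + 1) = n + 1 + j by ring, show (n : ℤ) - (j + 1) = n - j - 1 by ring,
    a2, b2, a1, b1]
  push_cast
  generalize rp (q ^ 2) (n + 1 + j) = u
  generalize rp (q ^ 2) (n + 1 - j) = v
  generalize poch (q ^ 2) (2 * n) = w
  have hQ0 : q ^ 2 ≠ 0 := pow_ne_zero _ hq0
  rw [show (j - 1) ^ 2 = j ^ 2 - j - j + 1 by ring, show (j + 1) ^ 2 = j ^ 2 + j + j + 1 by ring]
  have e : ∀ m : ℤ, (q ^ 2) ^ m = (q ^ m) ^ 2 := fun m => by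
    rw [← zpow_natCast, ← zpow_mul, ← zpow_natCast, ← zpow_mul, mul_comm]
  simp only [e, zpow_add₀ hq0, zpow_sub₀ hq0, zpow_natCast, zpow_one, pow_add, pow_mul]
  have hX : q ^ j ≠ 0 := zpow_ne_zero _ hq0
  generalize q ^ j = X at *
  generalize q ^ (j ^ 2) = Y at *
  have hN : q ^ n ≠ 0 := pow_ne_zero _ hq0
  simp only [← pow_mul, mul_comm _ n]
  simp only [pow_mul]
  generalize q ^ n = N at *
  field_simp
  ring

lemma finite_jtp (q z : ℂ) (hq0 : q ≠ 0) (hq : ‖q‖ < 1) (hz : z ≠ 0) (n : ℕ) :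
    HasSum (fun j : ℤ => cf q n j * (q ^ (j ^ 2) * z ^ j))
      (∏ k ∈ Finset.range n, ((1 + z * q ^ (2 * k + 1)) * (1 + z⁻¹ * q ^ (2 * k + 1)))) := by
  induction n with
  | zero =>
    convert hasSum_single (0 : ℤ) ?_ using 1
    · simp [cf, rp, poch]
    · intro j hj
      rw [cf_zero_of q 0 j (by simpa using hj), zero_mul]
  | succ n ih =>
    rw [Finset.prod_range_succ]
    have h1 := ih.mul_left (1 + q ^ (4 * n + 2))
    have h2 := ((Equiv.subRight (1 : ℤ)).hasSum_iff.2 ih).mul_left (q ^ (2 * n + 1) * z)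
    have h3 := ((Equiv.addRight (1 : ℤ)).hasSum_iff.2 ih).mul_left (q ^ (2 * n + 1) * z⁻¹)
    have key := (h1.add h2).add h3
    have e1 : (fun j : ℤ => cf q (n + 1) j * (q ^ (j ^ 2) * z ^ j)) = _ := funext fun j => by
      have := cf_rec q hq0 hq n j
      show _ = (1 + q ^ (4 * n + 2)) * (cf q n j * (q ^ j ^ 2 * z ^ j))
        + q ^ (2 * n + 1) * z * (cf q n (j - 1) * (q ^ (j - 1) ^ 2 * z ^ (j - 1)))
        + q ^ (2 * n + 1) * z⁻¹ * (cf q n (j + 1) * (q ^ (j + 1) ^ 2 * z ^ (j + 1)))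
      rw [← mul_assoc, this, zpow_sub₀ hz, zpow_add₀ hz, zpow_one]
      field_simp
    rw [e1]
    generalize (∏ k ∈ Finset.range n, ((1 + z * q ^ (2 * k + 1)) * (1 + z⁻¹ * q ^ (2 * k + 1)))) = P
      at key ⊢
    have e2 : P * ((1 + z * q ^ (2 * n + 1)) * (1 + z⁻¹ * q ^ (2 * n + 1)))
        = (1 + q ^ (4 * n + 2)) * P + q ^ (2 * n + 1) * z * P + q ^ (2 * n + 1) * z⁻¹ * P := by
      field_simp
      ring
    rw [e2]
    exact key

lemma mult_pow (Q : ℂ) (hQ : ‖Q‖ < 1) (c : ℂ) :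
    Multipliable fun n : ℕ => 1 + c * Q ^ n := by
  apply multipliable_one_add_of_summable
  simpa using (summable_geometric_of_lt_one (norm_nonneg _) hQ).mul_left ‖c‖

lemma mult_pow' (q : ℂ) (hq : ‖q‖ < 1) (c : ℂ) (b : ℕ) :
    Multipliable fun n : ℕ => 1 + c * q ^ (2 * n + b) := by
  have := mult_pow (q ^ 2) (by
    rw [norm_pow]; exact pow_lt_one₀ (norm_nonneg _) hq two_ne_zero) (c * q ^ b)
  refine this.congr fun n => ?_
  rw [pow_add, pow_mul]; ring

noncomputable def ep (x : ℂ) : ℂ := ∏' n : ℕ, (1 - x ^ (n + 1))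

lemma ep_ne (x : ℂ) (hx : ‖x‖ < 1) : ep x ≠ 0 := by
  have := tprod_one_add_ne_zero_of_summable (f := fun n : ℕ => - x ^ (n + 1))
    (fun i => by simpa [← sub_eq_add_neg] using one_sub_pow_ne x hx i)
    (by simpa using (summable_nat_add_iff 1).mpr (summable_geometric_of_lt_one (norm_nonneg _) hx))
  simpa [ep, sub_eq_add_neg] using this

lemma poch_tendsto (Q : ℂ) (hQ : ‖Q‖ < 1) : Tendsto (poch Q) atTop (𝓝 (ep Q)) :=
  (ModularForm.multipliable_one_sub_pow hQ).tendsto_prod_tprod_nat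

lemma jtp (q z : ℂ) (hq0 : q ≠ 0) (hq : ‖q‖ < 1) (hz : z ≠ 0) :
    ∑' j : ℤ, q ^ (j ^ 2) * z ^ j = ep (q ^ 2) * ((∏' k : ℕ, (1 + z * q ^ (2 * k + 1)))
      * ∏' k : ℕ, (1 + z⁻¹ * q ^ (2 * k + 1))) := by
  have hQ : ‖q ^ 2‖ < 1 := by
    rw [norm_pow]; exact pow_lt_one₀ (norm_nonneg _) hq two_ne_zero
  have hep := ep_ne _ hQ
  have ht := poch_tendsto _ hQ
  have hti := ht.inv₀ hep
  obtain ⟨C, hC⟩ := ht.norm.bddAbove_range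
  obtain ⟨D, hD⟩ := hti.norm.bddAbove_range
  have hC' : ∀ n, ‖poch (q ^ 2) n‖ ≤ C := fun n => hC ⟨n, rfl⟩
  have hD0 : 0 ≤ D := (norm_nonneg _).trans (hD ⟨0, rfl⟩)
  have hC0 : 0 ≤ C := (norm_nonneg _).trans (hC' 0)
  have hD' : ∀ m, ‖rp (q ^ 2) m‖ ≤ D := fun m => by
    unfold rp
    split_ifs
    · simpa using hD0
    · exact hD ⟨m.toNat, rfl⟩
  have hrp : Tendsto (rp (q ^ 2)) atTop (𝓝 (ep (q ^ 2))⁻¹) := by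
    have h1 : Tendsto Int.toNat atTop atTop :=
      tendsto_atTop.2 fun b => (eventually_ge_atTop (b : ℤ)).mono fun m hm => by omega
    refine (hti.comp h1).congr' ?_
    filter_upwards [eventually_ge_atTop (0 : ℤ)] with m hm
    simp [rp, not_lt.2 hm]
  have hcf : ∀ j, Tendsto (fun n => cf q n j) atTop (𝓝 (ep (q ^ 2))⁻¹) := fun j => by
    have h1 : Tendsto (fun n : ℕ => 2 * n) atTop atTop :=
      tendsto_atTop.2 fun b => (eventually_ge_atTop b).mono fun m hm => by omega
    have h2 : Tendsto (fun n : ℕ => (n : ℤ) + j) atTop atTop :=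
      tendsto_atTop_add_const_right _ _ tendsto_natCast_atTop_atTop
    have h3 : Tendsto (fun n : ℕ => (n : ℤ) - j) atTop atTop :=
      tendsto_atTop_add_const_right _ (-j) tendsto_natCast_atTop_atTop
    have := ((ht.comp h1).mul (hrp.comp h2)).mul (hrp.comp h3)
    rw [mul_inv_cancel₀ hep, one_mul] at this
    exact this
  have hs := aux_summable q z hq0 hq hz
  have lim1 := tendsto_tsum_of_dominated_convergence (𝓕 := atTop)
    (f := fun (n : ℕ) (j : ℤ) => cf q n j * (q ^ (j ^ 2) * z ^ j))
    (g := fun j : ℤ => (ep (q ^ 2))⁻¹ * (q ^ (j ^ 2) * z ^ j))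
    (bound := fun j : ℤ => (C * D * D) * ‖q ^ (j ^ 2) * z ^ j‖) (hs.mul_left _)
    (fun j => (hcf j).mul_const _) (Eventually.of_forall fun n j => by
      rw [norm_mul]
      refine mul_le_mul_of_nonneg_right ?_ (norm_nonneg _)
      unfold cf
      rw [norm_mul, norm_mul]
      gcongr
      · exact hC' _
      · exact hD' _
      · exact hD' _)
  have m1 := mult_pow' q hq z 1
  have m2 := mult_pow' q hq z⁻¹ 1
  have lim2 := m1.tendsto_prod_tprod_nat.mul m2.tendsto_prod_tprod_nat
  have := tendsto_nhds_unique lim1 (lim2.congr fun n => by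
    rw [(finite_jtp q z hq0 hq hz n).tsum_eq, Finset.prod_mul_distrib])
  rw [tsum_mul_left] at this
  rw [← this, mul_inv_cancel_left₀ hep]

lemma T3_prod (q : ℂ) (hq0 : q ≠ 0) (hq : ‖q‖ < 1) :
    T3 q = ep (q ^ 2) * (∏' k : ℕ, (1 + q ^ (2 * k + 1))) ^ 2 := by
  have := jtp q 1 hq0 hq one_ne_zero
  simpa [T3, sq] using this

lemma T3_prod_neg (q : ℂ) (hq0 : q ≠ 0) (hq : ‖q‖ < 1) :
    T3 (-q) = ep (q ^ 2) * (∏' k : ℕ, (1 - q ^ (2 * k + 1))) ^ 2 := by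
  rw [T3_prod (-q) (neg_ne_zero.2 hq0) (by rwa [norm_neg]), neg_sq]
  congr 3
  funext k
  rw [Odd.neg_pow ⟨k, rfl⟩, sub_eq_add_neg]

lemma T2_prod (q : ℂ) (hq0 : q ≠ 0) (hq : ‖q‖ < 1) :
    T2 q = 2 * ep (q ^ 2) * (∏' k : ℕ, (1 + q ^ (2 * k + 2))) ^ 2 := by
  have h := jtp q q hq0 hq hq0
  have h1 : ∀ k : ℕ, 1 + q * q ^ (2 * k + 1) = 1 + q ^ (2 * k + 2) := fun k => by ring
  have h2 : ∀ k : ℕ, 1 + q⁻¹ * q ^ (2 * k + 1) = 1 + q ^ (2 * k) := fun k => by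
    field_simp
    ring
  simp only [h1, h2] at h
  have m : Multipliable fun k : ℕ => 1 + q ^ (2 * (k + 1)) := by
    simpa [mul_add] using mult_pow' q hq 1 2
  have h3 := tprod_eq_zero_mul' (f := fun k : ℕ => 1 + q ^ (2 * k)) m
  rw [h3] at h
  unfold T2
  simp only [zpow_add₀ hq0, h, mul_add]
  norm_num
  ring

theorem prod_identity (q : ℂ) (hq0 : q ≠ 0) (hq : ‖q‖ < 1) :
    (∏' k : ℕ, (1 + q ^ (2 * k + 1))) ^ 8 - (∏' k : ℕ, (1 - q ^ (2 * k + 1))) ^ 8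
      = 16 * q * (∏' k : ℕ, (1 + q ^ (2 * k + 2))) ^ 8 := by
  have h := jacobi_series q hq0 hq
  have hQ : ‖q ^ 2‖ < 1 := by
    rw [norm_pow]; exact pow_lt_one₀ (norm_nonneg _) hq two_ne_zero
  rw [T3_prod q hq0 hq, T3_prod_neg q hq0 hq, T2_prod q hq0 hq] at h
  have hep := pow_ne_zero 4 (ep_ne _ hQ)
  apply mul_left_cancel₀ hep
  linear_combination h

lemma ep_split (x : ℂ) (hx : ‖x‖ < 1) :
    ep x = (∏' k : ℕ, (1 - x ^ (2 * k + 1))) * ep (x ^ 2) := by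
  unfold ep
  have h1 : Multipliable fun k : ℕ => 1 - x ^ (2 * k + 1) := by
    simpa [sub_eq_add_neg] using mult_pow' x hx (-1) 1
  have h2 : Multipliable fun k : ℕ => 1 - x ^ (2 * k + 1 + 1) := by
    simpa [sub_eq_add_neg] using mult_pow' x hx (-1) 2
  rw [← tprod_even_mul_odd (f := fun n : ℕ => 1 - x ^ (n + 1)) h1 h2]
  congr 2
  funext k
  rw [← pow_mul]; ring_nf

lemma ep_sq (q : ℂ) (hq : ‖q‖ < 1) :
    ep (q ^ 4) = ep (q ^ 2) * ∏' k : ℕ, (1 + q ^ (2 * k + 2)) := by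
  unfold ep
  have h1 : Multipliable fun k : ℕ => 1 - (q ^ 2) ^ (k + 1) :=
    ModularForm.multipliable_one_sub_pow (by
      rw [norm_pow]; exact pow_lt_one₀ (norm_nonneg _) hq two_ne_zero)
  have h2 : Multipliable fun k : ℕ => 1 + q ^ (2 * k + 2) := by
    simpa using mult_pow' q hq 1 2
  rw [← h1.tprod_mul h2]
  congr 1
  funext k
  ring

lemma AB (q : ℂ) (hq : ‖q‖ < 1) :
    (∏' k : ℕ, (1 + q ^ (2 * k + 1))) * (∏' k : ℕ, (1 - q ^ (2 * k + 1)))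
      = ∏' k : ℕ, (1 - (q ^ 2) ^ (2 * k + 1)) := by
  have h1 : Multipliable fun k : ℕ => 1 - q ^ (2 * k + 1) := by
    simpa [sub_eq_add_neg] using mult_pow' q hq (-1) 1
  have h2 : Multipliable fun k : ℕ => 1 + q ^ (2 * k + 1) := by
    simpa using mult_pow' q hq 1 1
  rw [← h2.tprod_mul h1]
  congr 1
  funext k
  ring

lemma eta_eq (τ : ℂ) : eta τ = Complex.exp (Real.pi * Complex.I * τ / 12) *
    ep (Complex.exp (2 * Real.pi * Complex.I * τ)) := by
  unfold eta ep
  congr 2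
  funext n
  rw [← Complex.exp_nat_mul]
  congr 2
  push_cast; ring

/-- for all τ in the upper half-plane,
    η(τ/2)^8/η(2τ)^8 − η(τ)^24/(η(τ/2)^8 η(2τ)^16) = −16. -/
theorem statement14 (τ : ℂ) (hτ : 0 < τ.im) :
    eta (τ / 2) ^ 8 / eta (2 * τ) ^ 8
      - eta τ ^ 24 / (eta (τ / 2) ^ 8 * eta (2 * τ) ^ 16) = -16 := by
  obtain ⟨q, hqd⟩ : ∃ q, q = Complex.exp (Real.pi * Complex.I * τ) := ⟨_, rfl⟩
  obtain ⟨r, hr⟩ : ∃ r, r = Complex.exp (Real.pi * Complex.I * τ / 24) := ⟨_, rfl⟩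
  have hq0 : q ≠ 0 := hqd ▸ Complex.exp_ne_zero _
  have hr0 : r ≠ 0 := hr ▸ Complex.exp_ne_zero _
  have hq : ‖q‖ < 1 := by
    rw [hqd, Complex.norm_exp, Real.exp_lt_one_iff]
    have : (Real.pi * Complex.I * τ).re = -(Real.pi * τ.im) := by simp
    rw [this]
    have := mul_pos Real.pi_pos hτ
    linarith
  have hn : ∀ n : ℕ, n ≠ 0 → ‖q ^ n‖ < 1 := fun n h => by
    rw [norm_pow]; exact pow_lt_one₀ (norm_nonneg _) hq h
  have hrq : q = r ^ 24 := by
    rw [hqd, hr, ← Complex.exp_nat_mul]; congr 1; push_cast; ring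
  have e1 : eta (τ / 2) = r * ep q := by
    rw [eta_eq, hqd, hr]; congr 2 <;> ring_nf
  have e2 : eta τ = r ^ 2 * ep (q ^ 2) := by
    rw [eta_eq, hqd, hr, ← Complex.exp_nat_mul, ← Complex.exp_nat_mul]
    congr 2 <;> push_cast <;> ring_nf
  have e3 : eta (2 * τ) = r ^ 4 * ep (q ^ 4) := by
    rw [eta_eq, hqd, hr, ← Complex.exp_nat_mul, ← Complex.exp_nat_mul]
    congr 2 <;> push_cast <;> ring_nf
  have n1 := ep_ne q hq
  have n2 := ep_ne _ (hn 2 (by norm_num))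
  have n4 := ep_ne _ (hn 4 (by norm_num))
  have p := prod_identity q hq0 hq
  have s1 := ep_split q hq
  have s2 := ep_split _ (hn 2 (by norm_num))
  have s3 := ep_sq q hq
  rw [← AB q hq, ← pow_mul, s3] at s2
  rw [e1, e2, e3]
  generalize (∏' k : ℕ, (1 + q ^ (2 * k + 1))) = A at *
  generalize (∏' k : ℕ, (1 - q ^ (2 * k + 1))) = B at *
  generalize (∏' k : ℕ, (1 + q ^ (2 * k + 2))) = C at *
  generalize ep (q ^ 2) = G at *
  have habc : A * B * C = 1 := by
    apply mul_left_cancel₀ n2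
    linear_combination -s2
  rw [s1] at n1 ⊢
  rw [s3] at n4 ⊢
  have hB : B ≠ 0 := left_ne_zero_of_mul n1
  have hC : C ≠ 0 := right_ne_zero_of_mul n4
  have h8 : A ^ 8 * B ^ 8 * C ^ 8 = 1 := by
    rw [← mul_pow, ← mul_pow, habc, one_pow]
  rw [hrq] at p
  field_simp
  linear_combination (-B ^ 8 * C ^ 8) * p + h8
end

section
/- For every τ in the upper half-plane, η(3τ/2)^{8}/η(3τ)^{8} − η(3τ)^{16}/(η(3τ/2)^{8} η(6τ)^{8}) + 16·η(6τ)^{8}/η(3τ)^{8} = 0. (This expresses that the g-twisted supertrace function f_{3D}(0,0;τ) for the class 3D of Co₀, with Frame shape 3⁸ and dual Frame shape 6⁸/3⁸ and coefficient C_{−g} = 16, vanishes identically.) -/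
open scoped Real

namespace S15
open Complex hiding eta
open UpperHalfPlane hiding I
open Filter Topology MatrixGroups
open scoped ModularForm

noncomputable def P (q : ℂ) : ℂ := ∏' n : ℕ, (1 - q ^ (n + 1))
noncomputable def O (q : ℂ) : ℂ := ∏' n : ℕ, (1 - q ^ (2 * n + 1))

lemma P_zero : P 0 = 1 := by simp [P]

lemma P_diff {q : ℂ} (hq : ‖q‖ < 1) : DifferentiableAt ℂ P q :=
  (ModularForm.differentiableOn_tprod_one_sub_pow).differentiableAt
    (Metric.isOpen_ball.mem_nhds (by simpa using hq))

lemma mulO {q : ℂ} (hq : ‖q‖ < 1) : Multipliable fun n : ℕ ↦ 1 - q ^ (2 * n + 1) := by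
  have := multipliable_one_add_of_summable (f := fun n : ℕ ↦ -q ^ (2 * n + 1)) (by
    have h := summable_geometric_of_lt_one (norm_nonneg q) hq
    have h2 := h.comp_injective (i := fun n : ℕ => 2 * n + 1) (fun a b h => by simp at h; exact h)
    simpa [Function.comp_def] using h2)
  simpa [sub_eq_add_neg] using this

lemma sq_lt {q : ℂ} (hq : ‖q‖ < 1) : ‖q ^ 2‖ < 1 := by
  rw [norm_pow]; exact pow_lt_one₀ (norm_nonneg _) hq two_ne_zero

lemma P_split {q : ℂ} (hq : ‖q‖ < 1) : P q = O q * P (q ^ 2) := by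
  have h2 := ModularForm.multipliable_one_sub_pow (sq_lt hq)
  have := tprod_even_mul_odd (f := fun n : ℕ ↦ 1 - q ^ (n + 1)) (mulO hq) (by
    refine h2.congr fun n => ?_
    rw [← pow_mul]; ring_nf)
  rw [P, ← this, O, P]
  congr 1
  refine tprod_congr fun n => ?_
  rw [← pow_mul]; ring_nf

lemma O_neg {q : ℂ} (hq : ‖q‖ < 1) : O (-q) * O q = O (q ^ 2) := by
  rw [O, O, O, ← Multipliable.tprod_mul (mulO (by simpa using hq)) (mulO hq)]
  refine tprod_congr fun n => ?_
  rw [Odd.neg_pow ⟨n, rfl⟩, ← pow_mul]; ring_nf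

lemma P_neg {q : ℂ} (hq : ‖q‖ < 1) : P (-q) * P q * P (q ^ 4) = P (q ^ 2) ^ 3 := by
  have h1 := P_split hq
  have h2 := P_split (q := -q) (by simpa using hq)
  have h3 := P_split (sq_lt hq)
  have h4 := O_neg hq
  rw [neg_sq] at h2
  rw [← pow_mul] at h3
  norm_num at h3
  rw [h1, h2]
  calc _ = P (q^2)^2 * ((O (-q) * O q) * P (q ^ 4)) := by ring
    _ = _ := by rw [h4, ← h3]; ring

/-- the bracket -/
noncomputable def H (x : ℂ) : ℂ :=
  P (x ^ 2) ^ 16 / (P x ^ 8 * P (x ^ 4) ^ 8) - P x ^ 8 / P (x ^ 2) ^ 8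
    - 16 * x * P (x ^ 4) ^ 8 / P (x ^ 2) ^ 8

lemma H_neg {q : ℂ} (hq : ‖q‖ < 1) (h1 : P q ≠ 0) (h2 : P (q ^ 2) ≠ 0) (h4 : P (q ^ 4) ≠ 0) :
    H (-q) = - H q := by
  have h : P (-q) = P (q ^ 2) ^ 3 / (P q * P (q ^ 4)) := by
    rw [eq_div_iff (mul_ne_zero h1 h4), ← P_neg hq]; ring
  have e4 : (-q) ^ 4 = q ^ 4 := by ring
  unfold H
  rw [neg_sq, e4, h]
  field_simp
  ring

lemma H_lim : Tendsto (fun x : ℂ => H x ^ 3 / x) (𝓝[≠] 0) (𝓝 0) := by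
  have hd : DifferentiableAt ℂ H 0 := by
    have a1 : DifferentiableAt ℂ P 0 := P_diff (by simp)
    have a2 : DifferentiableAt ℂ (fun x : ℂ => P (x ^ 2)) 0 :=
      DifferentiableAt.comp (g := P) (f := fun x : ℂ => x ^ 2) 0 (P_diff (by simp)) (by fun_prop)
    have a4 : DifferentiableAt ℂ (fun x : ℂ => P (x ^ 4)) 0 :=
      DifferentiableAt.comp (g := P) (f := fun x : ℂ => x ^ 4) 0 (P_diff (by simp)) (by fun_prop)
    unfold H
    refine ((DifferentiableAt.div (a2.pow 16) ((a1.pow 8).mul (a4.pow 8)) ?_).sub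
      (DifferentiableAt.div (a1.pow 8) (a2.pow 8) ?_)).sub
      (DifferentiableAt.div ((by fun_prop : DifferentiableAt ℂ (fun x : ℂ => 16 * x) 0).mul (a4.pow 8)) (a2.pow 8) ?_)
      <;> simp [P_zero]
  have h0 : H 0 = 0 := by simp [H, P_zero]
  have hs := hd.hasDerivAt.tendsto_slope_zero
  have hc : Tendsto H (𝓝[≠] 0) (𝓝 0) := by
    have := hd.continuousAt.tendsto
    rw [h0] at this
    exact this.mono_left nhdsWithin_le_nhds
  have := (hs.mul (hc.pow 2))
  simp only [zero_add, h0, sub_zero, smul_eq_mul] at this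
  refine (this.congr fun x => ?_).trans (by simp)
  rw [div_eq_mul_inv]; ring

lemma eta_eq (z : ℂ) : eta z = ModularForm.eta z := by
  unfold eta ModularForm.eta
  congr 1
  · rw [Function.Periodic.qParam]; congr 1; push_cast; ring
  · refine tprod_congr fun n => ?_
    rw [ModularForm.eta_q_eq_cexp]

lemma eta_P (z : ℂ) : eta z = exp (Real.pi * I * z / 12) * P (exp (2 * Real.pi * I * z)) := by
  unfold eta P
  congr 1
  refine tprod_congr fun n => ?_
  rw [← Complex.exp_nat_mul]; congr 2; push_cast; ring

lemma eta_ne {z : ℂ} (hz : 0 < z.im) : eta z ≠ 0 := by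
  rw [eta_eq]; exact ModularForm.eta_ne_zero hz

lemma eta_diff {z : ℂ} (hz : 0 < z.im) : DifferentiableAt ℂ eta z := by
  rw [show eta = ModularForm.eta from funext eta_eq]
  exact ModularForm.differentiableAt_eta_of_mem_upperHalfPlaneSet hz

lemma sqrt8 {z : ℂ} (hz : z ≠ 0) : sqrt z ^ 8 = z ^ 4 := by
  rw [sqrt_eq_exp hz, ← exp_nat_mul]
  ring_nf
  rw [show (log z * 4) = (4 : ℕ) * log z by push_cast; ring, exp_nat_mul, exp_log hz]

lemma eta_S {z : ℂ} (hz : 0 < z.im) : eta (-1 / z) ^ 8 = z ^ 4 * eta z ^ 8 := by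
  have h := ModularForm.eta_comp_eq_csqrt_I_inv hz
  have hz0 : z ≠ 0 := by rintro rfl; simp at hz
  simp only [Function.comp_apply, Pi.smul_apply, Pi.mul_apply, smul_eq_mul] at h
  rw [eta_eq, eta_eq, h, mul_pow, mul_pow, inv_pow, sqrt8 I_ne_zero, sqrt8 hz0, I_pow_four]
  simp

noncomputable def F (t : ℂ) : ℂ :=
  eta t ^ 16 / (eta (t / 2) ^ 8 * eta (2 * t) ^ 8) - eta (t / 2) ^ 8 / eta t ^ 8
    - 16 * eta (2 * t) ^ 8 / eta t ^ 8

lemma F_S {t : ℂ} (ht : 0 < t.im) : F (-1 / t) = F t := by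
  have ht2 : 0 < (t / 2).im := by simpa using ht
  have h2t : 0 < (2 * t).im := by simpa using ht
  have ht0 : t ≠ 0 := by rintro rfl; simp at ht
  have e0 := eta_S ht
  have e1 := eta_S ht2
  have e2 := eta_S h2t
  have n0 := eta_ne ht
  have n1 := eta_ne ht2
  have n2 := eta_ne h2t
  rw [show -1 / (t / 2) = 2 * (-1 / t) by field_simp] at e1
  rw [show -1 / (2 * t) = -1 / t / 2 by field_simp] at e2
  unfold F
  rw [show eta (-1 / t) ^ 16 = (eta (-1 / t) ^ 8) ^ 2 by ring, e0, e1, e2]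
  clear e0 e1 e2
  generalize eta (2 * t) = c at *
  generalize eta (t / 2) = b at *
  generalize eta t = a at *
  field_simp
  ring

lemma F_H {t : ℂ} (ht : 0 < t.im) :
    F t ^ 3 = H (exp (Real.pi * I * t)) ^ 3 / exp (Real.pi * I * t) := by
  have ht2 : 0 < (t / 2).im := by simpa using ht
  have h2t : 0 < (2 * t).im := by simpa using ht
  have n0 := eta_ne ht
  have n1 := eta_ne ht2
  have n2 := eta_ne h2t
  have q0 := eta_P t
  have q1 := eta_P (t / 2)
  have q2 := eta_P (2 * t)
  set y := exp (Real.pi * I * t / 24) with hy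
  have y0 : y ≠ 0 := exp_ne_zero _
  have hx : exp (Real.pi * I * t) = y ^ 24 := by
    rw [hy, ← exp_nat_mul]; congr 1; push_cast; ring
  rw [show exp (Real.pi * I * t / 12) = y ^ 2 by
      rw [hy, ← exp_nat_mul]; congr 1; push_cast; ring,
    show exp (2 * Real.pi * I * t) = (y ^ 24) ^ 2 by
      rw [hy, ← pow_mul, ← exp_nat_mul]; congr 1; push_cast; ring] at q0
  rw [show exp (Real.pi * I * (t / 2) / 12) = y by
      rw [hy]; congr 1; ring,
    show exp (2 * Real.pi * I * (t / 2)) = (y ^ 24) by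
      rw [hy, ← exp_nat_mul]; congr 1; push_cast; ring] at q1
  rw [show exp (Real.pi * I * (2 * t) / 12) = y ^ 4 by
      rw [hy, ← exp_nat_mul]; congr 1; push_cast; ring,
    show exp (2 * Real.pi * I * (2 * t)) = (y ^ 24) ^ 4 by
      rw [hy, ← pow_mul, ← exp_nat_mul]; congr 1; push_cast; ring] at q2
  rw [hx]
  have key : F t = H (y ^ 24) / y ^ 8 := by
    unfold F H
    rw [q0] at n0 ⊢
    rw [q1] at n1 ⊢
    rw [q2] at n2 ⊢
    generalize P (y ^ 24) = a at *
    generalize P ((y ^ 24) ^ 2) = b at *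
    generalize P ((y ^ 24) ^ 4) = c at *
    have := right_ne_zero_of_mul n0
    have := right_ne_zero_of_mul n1
    have := right_ne_zero_of_mul n2
    field_simp
  rw [key, div_pow, ← pow_mul]

lemma norm_x {t : ℂ} (ht : 0 < t.im) : ‖exp (Real.pi * I * t)‖ < 1 := by
  rw [norm_exp]; simp; positivity

lemma F_T {t : ℂ} (ht : 0 < t.im) : F (t + 1) ^ 3 = F t ^ 3 := by
  have ht1 : 0 < (t + 1).im := by simpa using ht
  have ht2 : 0 < (t / 2).im := by simpa using ht
  have h2t : 0 < (2 * t).im := by simpa using ht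
  rw [F_H ht1, F_H ht]
  have : exp (Real.pi * I * (t + 1)) = - exp (Real.pi * I * t) := by
    rw [mul_add, exp_add, mul_one, exp_pi_mul_I]; ring
  have n0 := eta_ne ht
  have n1 := eta_ne ht2
  have n2 := eta_ne h2t
  rw [eta_P] at n0 n1 n2
  rw [this, H_neg (norm_x ht)]
  · rw [Odd.neg_pow (by decide), neg_div_neg_eq]
  · convert right_ne_zero_of_mul n1 using 3; ring
  · convert right_ne_zero_of_mul n0 using 2
    rw [← exp_nat_mul]; congr 1; push_cast; ring
  · convert right_ne_zero_of_mul n2 using 2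
    rw [← exp_nat_mul]; congr 1; push_cast; ring

noncomputable def G (t : ℍ) : ℂ := F t ^ 3

lemma G_zero : IsZeroAtImInfty G := by
  have hx : Tendsto (fun t : ℍ => exp (Real.pi * I * t)) atImInfty (𝓝[≠] 0) := by
    rw [tendsto_nhdsWithin_iff]
    refine ⟨?_, Eventually.of_forall fun t => exp_ne_zero _⟩
    convert UpperHalfPlane.qParam_tendsto_atImInfty (h := 2) two_pos using 2 with t
    rw [Function.Periodic.qParam]; congr 1; push_cast; ring
  exact (H_lim.comp hx).congr fun t => (F_H t.2).symm

lemma G_S : (G ∣[(0 : ℤ)] ModularGroup.S) = G := by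
  ext z
  rw [ModularForm.SL_slash_apply, UpperHalfPlane.modular_S_smul]
  have := F_S z.2
  simp only [G, neg_zero, zpow_zero, mul_one]
  rw [← this]
  congr 2
  simp [neg_div, inv_neg]

lemma G_T : (G ∣[(0 : ℤ)] ModularGroup.T) = G := by
  ext z
  rw [ModularForm.SL_slash_apply, UpperHalfPlane.modular_T_smul]
  have := F_T z.2
  simp only [G, neg_zero, zpow_zero, mul_one]
  rw [← this]
  congr 2
  simp [add_comm]

lemma F_diff {t : ℂ} (ht : 0 < t.im) : DifferentiableAt ℂ F t := by
  have ht2 : 0 < (t / 2).im := by simpa using ht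
  have h2t : 0 < (2 * t).im := by simpa using ht
  have n0 := eta_ne ht
  have n1 := eta_ne ht2
  have n2 := eta_ne h2t
  have a0 := eta_diff ht
  have a1 : DifferentiableAt ℂ (fun t => eta (t / 2)) t :=
    DifferentiableAt.comp (g := eta) (f := fun t => t / 2) t (eta_diff ht2) (by fun_prop)
  have a2 : DifferentiableAt ℂ (fun t => eta (2 * t)) t :=
    DifferentiableAt.comp (g := eta) (f := fun t => 2 * t) t (eta_diff h2t) (by fun_prop)
  unfold F
  refine ((DifferentiableAt.div (a0.pow 16) ((a1.pow 8).mul (a2.pow 8)) ?_).sub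
      (DifferentiableAt.div (a1.pow 8) (a0.pow 8) ?_)).sub
      (DifferentiableAt.div ((a2.pow 8).const_mul 16) (a0.pow 8) ?_)
  · exact mul_ne_zero (pow_ne_zero _ n1) (pow_ne_zero _ n2)
  · exact pow_ne_zero _ n0
  · exact pow_ne_zero _ n0

noncomputable def Gform : ModularForm 𝒮ℒ 0 where
  toFun := G
  slash_action_eq' A hA := by
    obtain ⟨A, rfl⟩ := hA
    exact SlashInvariantForm.slash_action_generators_SL2Z G_S G_T A
  holo' := by
    rw [UpperHalfPlane.mdifferentiable_iff]
    refine .congr (fun z hz ↦ ((F_diff hz).pow 3).differentiableWithinAt) fun z hz ↦ ?_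
    simp [G, ofComplex_apply_of_im_pos hz]
  bdd_at_cusps' hc := by
    rw [Subgroup.IsArithmetic.isCusp_iff_isCusp_SL2Z] at hc
    rw [OnePoint.isBoundedAt_iff_forall_SL2Z hc]
    intro γ _
    rw [SlashInvariantForm.slash_action_generators_SL2Z G_S G_T]
    exact G_zero.isBoundedAtImInfty

lemma F_eq_zero {t : ℂ} (ht : 0 < t.im) : F t = 0 := by
  obtain ⟨c, hc⟩ := ModularFormClass.levelOne_weight_zero_const Gform
  have hG : G = Function.const _ c := hc
  have h0 : Tendsto G atImInfty (𝓝 0) := G_zero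
  have hc0 : c = 0 := by
    rw [hG] at h0
    exact tendsto_nhds_unique tendsto_const_nhds h0
  have := congrFun hG ⟨t, ht⟩
  rw [hc0] at this
  exact pow_eq_zero_iff (n := 3) (by norm_num) |>.1 this

end S15

/-- for all τ in the upper half-plane,
    η(3τ/2)^8/η(3τ)^8 − η(3τ)^16/(η(3τ/2)^8 η(6τ)^8) + 16 η(6τ)^8/η(3τ)^8 = 0. -/
theorem statement15 (τ : ℂ) (hτ : 0 < τ.im) :
    eta (3 * τ / 2) ^ 8 / eta (3 * τ) ^ 8
      - eta (3 * τ) ^ 16 / (eta (3 * τ / 2) ^ 8 * eta (6 * τ) ^ 8)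
      + 16 * eta (6 * τ) ^ 8 / eta (3 * τ) ^ 8 = 0 := by
  have h := S15.F_eq_zero (t := 3 * τ) (by simpa using hτ)
  unfold S15.F at h
  rw [show 2 * (3 * τ) = 6 * τ by ring] at h
  linear_combination -h
end

section
/- For every τ in the upper half-plane, (η(3τ/2)^{9} η(τ)^{3})/(η(τ/2)^{3} η(3τ)^{9}) − (η(τ/2)^{3} η(2τ)^{3} η(3τ)^{18})/(η(τ)^{6} η(3τ/2)^{9} η(6τ)^{9}) − 8·(η(τ)^{3} η(6τ)^{9})/(η(2τ)^{3} η(3τ)^{9}) = 6. (This expresses that the g-twisted supertrace function f_{3C}(0,0;τ) for the class 3C of Co₀, with Frame shape 3⁹/1³, dual Frame shape 1³6⁹/2³3⁹, C_g = 0 and C_{−g} = −8, is identically equal to the constant 3.) -/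
open scoped Real

open Filter Topology

noncomputable def FP (a r : ℂ) : ℂ := ∏' n : ℕ, (1 - a * r ^ n)

lemma FP_mult (a : ℂ) {r : ℂ} (hr : ‖r‖ < 1) : Multipliable fun n : ℕ => (1 - a * r ^ n) := by
  have : Summable fun n : ℕ => ‖-(a * r ^ n)‖ := by
    simpa using (summable_geometric_of_lt_one (norm_nonneg _) hr).mul_left ‖a‖
  simpa [sub_eq_add_neg] using multipliable_one_add_of_summable this

lemma FP_tendsto (a : ℂ) {r : ℂ} (hr : ‖r‖ < 1) :
    Tendsto (fun N : ℕ => ∏ n ∈ Finset.range N, (1 - a * r ^ n)) atTop (𝓝 (FP a r)) :=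
  (FP_mult a hr).hasProd.tendsto_prod_nat

lemma norm_pow_lt {r : ℂ} (hr : ‖r‖ < 1) {k : ℕ} (hk : k ≠ 0) : ‖r ^ k‖ < 1 := by
  rw [norm_pow]; exact pow_lt_one₀ (norm_nonneg _) hr hk

lemma FP_ne_zero {a r : ℂ} (ha : ‖a‖ < 1) (hr : ‖r‖ < 1) : FP a r ≠ 0 := by
  have : Summable fun n : ℕ => ‖-(a * r ^ n)‖ := by
    simpa using (summable_geometric_of_lt_one (norm_nonneg _) hr).mul_left ‖a‖
  have h := tprod_one_add_ne_zero_of_summable (f := fun n : ℕ => -(a * r ^ n)) ?_ this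
  · simpa [sub_eq_add_neg, FP] using h
  · intro n h0
    have h1 : a * r ^ n = 1 := by linear_combination -h0
    have h2 : ‖a * r ^ n‖ < 1 := by
      rw [norm_mul, norm_pow]
      calc ‖a‖ * ‖r‖ ^ n ≤ ‖a‖ * 1 := by
            gcongr; exact pow_le_one₀ (norm_nonneg _) hr.le
        _ < 1 := by simpa using ha
    rw [h1] at h2; simp at h2

/-- splitting by residue classes -/
lemma FP_split (a : ℂ) {r : ℂ} (hr : ‖r‖ < 1) {m : ℕ} (hm : m ≠ 0) :
    FP a r = ∏ j ∈ Finset.range m, FP (a * r ^ j) (r ^ m) := by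
  have h1 : Tendsto (fun N : ℕ => ∏ n ∈ Finset.range (m * N), (1 - a * r ^ n)) atTop
      (𝓝 (FP a r)) :=
    (FP_tendsto a hr).comp (tendsto_id.const_mul_atTop' (Nat.pos_of_ne_zero hm))
  have h2 := tendsto_finsetProd (Finset.range m) fun j _ =>
    FP_tendsto (a * r ^ j) (norm_pow_lt hr hm)
  refine tendsto_nhds_unique h1 (h2.congr fun N => ?_)
  rw [Finset.prod_comm]
  induction N with
  | zero => simp
  | succ N ih =>
    rw [Finset.prod_range_succ, ih, Nat.mul_succ, Finset.prod_range_add]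
    congr 1
    refine Finset.prod_congr rfl fun j _ => ?_
    ring

lemma FP_neg_mul (a : ℂ) {r : ℂ} (hr : ‖r‖ < 1) : FP (-a) r * FP a r = FP (a ^ 2) (r ^ 2) := by
  refine tendsto_nhds_unique ((FP_tendsto (-a) hr).mul (FP_tendsto a hr))
    ((FP_tendsto (a ^ 2) (norm_pow_lt hr two_ne_zero)).congr fun N => ?_)
  rw [← Finset.prod_mul_distrib]
  refine Finset.prod_congr rfl fun j _ => ?_
  ring

/-! q-binomial -/
noncomputable def gb (r : ℂ) : ℕ → ℕ → ℂ
  | _, 0 => 1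
  | 0, _ + 1 => 0
  | n + 1, k + 1 => r ^ (k + 1) * gb r n (k + 1) + gb r n k

lemma gb_zero_right (r : ℂ) (n : ℕ) : gb r n 0 = 1 := by cases n <;> simp [gb]

lemma gb_lt (r : ℂ) : ∀ n k : ℕ, n < k → gb r n k = 0
  | _, 0, h => by omega
  | 0, k + 1, _ => by simp [gb]
  | n + 1, k + 1, h => by
    rw [gb, gb_lt r n (k + 1) (by omega), gb_lt r n k (by omega)]; simp

noncomputable def DD (r : ℂ) (n : ℕ) : ℂ := ∏ i ∈ Finset.range n, (1 - r * r ^ i)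

lemma gb_DD (r : ℂ) : ∀ s a b : ℕ, a + b = s → gb r (a + b) a * (DD r a * DD r b) = DD r (a + b)
  | s, 0, b, _ => by simp [gb_zero_right, DD]
  | s, a + 1, 0, h => by
    have := gb_DD r (s - 1) a 0 (by omega)
    simp only [add_zero] at this ⊢
    rw [gb, gb_lt r a (a + 1) (by omega)]
    simp only [DD, Finset.prod_range_succ, Finset.prod_range_zero] at this ⊢
    linear_combination (1 - r * r ^ a) * this
  | s, a + 1, b + 1, h => by
    have h1 := gb_DD r (s - 1) (a + 1) b (by omega)
    have h2 := gb_DD r (s - 1) a (b + 1) (by omega)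
    have e : a + 1 + (b + 1) = (a + b + 1) + 1 := by ring
    have e1 : a + 1 + b = a + b + 1 := by ring
    have e2 : a + (b + 1) = a + b + 1 := by ring
    rw [e1] at h1
    rw [e2] at h2
    rw [e, gb]
    have d1 : DD r (a + 1) = DD r a * (1 - r * r ^ a) := Finset.prod_range_succ _ _
    have d2 : DD r (b + 1) = DD r b * (1 - r * r ^ b) := Finset.prod_range_succ _ _
    have d3 : DD r (a + b + 1 + 1) = DD r (a + b + 1) * (1 - r * r ^ (a + b + 1)) :=
      Finset.prod_range_succ _ _
    rw [d3]
    rw [d1] at h1 ⊢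
    rw [d2] at h2 ⊢
    linear_combination r ^ (a + 1) * (1 - r * r ^ b) * h1 + (1 - r * r ^ a) * h2
termination_by s => s
decreasing_by all_goals omega

/-- q-binomial theorem in base `p^2`. -/
lemma qbinom (p : ℂ) (hp : p ≠ 0) : ∀ (n : ℕ) (x : ℂ), ∏ j ∈ Finset.range n, (1 + x * (p ^ 2) ^ j) =
    ∑ k ∈ Finset.range (n + 1), gb (p ^ 2) n k * p ^ ((k : ℤ) * (k - 1)) * x ^ k
  | 0, x => by simp [gb]
  | n + 1, x => by
    rw [Finset.prod_range_succ']
    have h := qbinom p hp n (x * p ^ 2)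
    have e : ∏ k ∈ Finset.range n, (1 + x * (p ^ 2) ^ (k + 1)) =
        ∏ j ∈ Finset.range n, (1 + x * p ^ 2 * (p ^ 2) ^ j) :=
      Finset.prod_congr rfl fun j _ => by ring
    rw [e, h, Finset.sum_range_succ' _ (n + 1)]
    simp only [gb]
    simp only [add_mul, Finset.sum_add_distrib]
    have e3 : ∑ k ∈ Finset.range (n + 1), (p ^ 2) ^ (k + 1) * gb (p ^ 2) n (k + 1) *
        p ^ (((k + 1 : ℕ) : ℤ) * (((k + 1 : ℕ) : ℤ) - 1)) * x ^ (k + 1)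
        + 1 = ∑ k ∈ Finset.range (n + 1), gb (p ^ 2) n k * p ^ ((k : ℤ) * (k - 1)) * (x * p ^ 2) ^ k := by
      rw [Finset.sum_range_succ, gb_lt _ n (n + 1) (by omega), Finset.sum_range_succ']
      simp only [gb_zero_right]
      simp only [mul_zero, zero_mul, add_zero, Nat.cast_zero, zpow_zero, pow_zero, mul_one]
      congr 1
      refine Finset.sum_congr rfl fun k _ => ?_
      ring
    have e4 : ∑ k ∈ Finset.range (n + 1), gb (p ^ 2) n k *
        p ^ (((k + 1 : ℕ) : ℤ) * (((k + 1 : ℕ) : ℤ) - 1)) * x ^ (k + 1)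
        = x * ∑ k ∈ Finset.range (n + 1), gb (p ^ 2) n k * p ^ ((k : ℤ) * (k - 1)) * (x * p ^ 2) ^ k := by
      rw [Finset.mul_sum]
      refine Finset.sum_congr rfl fun k _ => ?_
      have : p ^ (((k + 1 : ℕ) : ℤ) * (((k + 1 : ℕ) : ℤ) - 1)) = p ^ ((k : ℤ) * (k - 1)) * (p ^ 2) ^ k := by
        rw [← pow_mul, ← zpow_natCast, ← zpow_add₀ hp]
        congr 1; push_cast; ring
      rw [this]; ring
    rw [e4, ← e3]
    simp
    ring

lemma first_half (p z : ℂ) (hp : p ≠ 0) (hz : z ≠ 0) (N : ℕ) :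
    ∏ j ∈ Finset.range N, (1 + (-z * p ^ (-(2 * N : ℤ))) * (p ^ 2) ^ j) =
      (-z) ^ N * p ^ (-(N * (N + 1) : ℤ)) * ∏ j ∈ Finset.range N, (1 - p ^ 2 / z * (p ^ 2) ^ j) := by
  induction N with
  | zero => simp
  | succ N ih =>
    rw [Finset.prod_range_succ', Finset.prod_range_succ (fun j => 1 - p ^ 2 / z * (p ^ 2) ^ j)]
    have e : ∏ k ∈ Finset.range N, (1 + (-z * p ^ (-(2 * (N + 1 : ℕ) : ℤ))) * (p ^ 2) ^ (k + 1)) =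
        ∏ j ∈ Finset.range N, (1 + (-z * p ^ (-(2 * N : ℤ))) * (p ^ 2) ^ j) := by
      refine Finset.prod_congr rfl fun k _ => ?_
      have : p ^ (-(2 * N : ℤ)) = p ^ (-(2 * (N + 1 : ℕ) : ℤ)) * p ^ 2 := by
        rw [← zpow_natCast, ← zpow_add₀ hp]; congr 1; push_cast; ring
      rw [this]; ring
    rw [e, ih]
    have e2 : p ^ (-(((N + 1 : ℕ) : ℤ) * (((N + 1 : ℕ) : ℤ) + 1))) =
        p ^ (-(N * (N + 1) : ℤ)) * p ^ (-(2 * (N + 1 : ℕ) : ℤ)) := by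
      rw [← zpow_add₀ hp]; congr 1; push_cast; ring
    rw [e2]
    have e3 : p ^ (-(2 * (N + 1 : ℕ) : ℤ)) * (p ^ 2 * (p ^ 2) ^ N) = 1 := by
      rw [← pow_succ', ← pow_mul, ← zpow_natCast, ← zpow_add₀ hp]
      convert zpow_zero p using 2
      push_cast; ring
    have e4 : (-z) * p ^ (-(2 * (N + 1 : ℕ) : ℤ)) * (1 - p ^ 2 / z * (p ^ 2) ^ N) =
        1 + (-z * p ^ (-(2 * (N + 1 : ℕ) : ℤ))) * (p ^ 2) ^ 0 := by
      field_simp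
      linear_combination e3
    rw [← e4]; ring

noncomputable def sterm (p z : ℂ) (m : ℤ) : ℂ := (-1) ^ m * p ^ (m * (m - 1)) * z ^ m

lemma finite_triple (p z : ℂ) (hp : p ≠ 0) (hz : z ≠ 0) (N : ℕ) :
    (∏ j ∈ Finset.range N, (1 - z * (p ^ 2) ^ j)) *
      ∏ j ∈ Finset.range N, (1 - p ^ 2 / z * (p ^ 2) ^ j) =
    ∑ m ∈ Finset.Icc (-(N : ℤ)) N, gb (p ^ 2) (N + N) (N + m).toNat * sterm p z m := by
  have h := qbinom p hp (N + N) (-z * p ^ (-(2 * N : ℤ)))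
  rw [Finset.prod_range_add, first_half p z hp hz] at h
  have e : ∏ x ∈ Finset.range N, (1 + -z * p ^ (-(2 * N : ℤ)) * (p ^ 2) ^ (N + x)) =
      ∏ j ∈ Finset.range N, (1 - z * (p ^ 2) ^ j) := by
    refine Finset.prod_congr rfl fun k _ => ?_
    have : p ^ (-(2 * N : ℤ)) * (p ^ 2) ^ N = 1 := by
      rw [← pow_mul, ← zpow_natCast, ← zpow_add₀ hp]
      convert zpow_zero p using 2
      push_cast; ring
    linear_combination -z * (p ^ 2) ^ k * this
  rw [e] at h
  have hc : (-z) ^ N * p ^ (-(N * (N + 1) : ℤ)) ≠ 0 :=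
    mul_ne_zero (pow_ne_zero _ (neg_ne_zero.2 hz)) (zpow_ne_zero _ hp)
  apply mul_left_cancel₀ hc
  rw [mul_comm (∏ j ∈ Finset.range N, (1 - z * (p ^ 2) ^ j))]
  rw [← mul_assoc, h, Finset.mul_sum]
  refine Finset.sum_bij' (fun k _ => (k : ℤ) - N) (fun m _ => (N + m).toNat) ?_ ?_ ?_ ?_ ?_
  · intro k hk; simp at hk ⊢; omega
  · intro k hk; simp at hk ⊢; omega
  · intro k hk; simp
  · intro k hk; simp at hk ⊢; omega
  · intro k hk
    have : ((N : ℤ) + (k - N)).toNat = k := by simp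
    rw [this, sterm]
    have a1 : (-z * p ^ (-(2 * N : ℤ))) ^ k = (-z) ^ k * p ^ (-(2 * N * k : ℤ)) := by
      rw [mul_pow, ← zpow_natCast (p ^ _), ← zpow_mul]; congr 2; ring
    have a2 : (-z) ^ k = (-z) ^ N * ((-1) ^ ((k : ℤ) - N) * z ^ ((k : ℤ) - N)) := by
      rw [← mul_zpow, ← zpow_natCast, ← zpow_natCast, neg_one_mul,
        ← zpow_add₀ (neg_ne_zero.2 hz)]
      congr 1; ring
    have a3 : p ^ ((k : ℤ) * (k - 1)) * p ^ (-(2 * N * k : ℤ)) =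
        p ^ (-(N * (N + 1) : ℤ)) * p ^ (((k : ℤ) - N) * ((k : ℤ) - N - 1)) := by
      rw [← zpow_add₀ hp, ← zpow_add₀ hp]; congr 1; ring
    rw [a1, a2]
    linear_combination gb (p ^ 2) (N + N) k * ((-z) ^ N * ((-1) ^ ((k : ℤ) - N) * z ^ ((k : ℤ) - N))) * a3

lemma summable_gauss (p z : ℂ) (hp : p ≠ 0) (hp1 : ‖p‖ < 1) (hz : z ≠ 0) :
    Summable fun n : ℤ => p ^ (n * n) * z ^ n := by
  have h := (summable_jacobiTheta₂_term_iff (Complex.log z / (2 * π * Complex.I))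
    (Complex.log p / (π * Complex.I))).2 ?_
  · refine h.congr fun n => ?_
    rw [jacobiTheta₂_term, Complex.exp_add]
    have hI := Complex.I_ne_zero
    have hpi : (π : ℂ) ≠ 0 := by exact_mod_cast Real.pi_ne_zero
    have e1 : 2 * π * Complex.I * n * (Complex.log z / (2 * π * Complex.I)) = n * Complex.log z := by
      field_simp
    have e2 : π * Complex.I * (n : ℂ) ^ 2 * (Complex.log p / (π * Complex.I)) =
        ((n * n : ℤ) : ℂ) * Complex.log p := by
      push_cast; field_simp
    rw [e1, e2, Complex.exp_int_mul, Complex.exp_int_mul, Complex.exp_log hz, Complex.exp_log hp,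
      mul_comm]
  · have : Complex.log p / (π * Complex.I) = -(Complex.I * Complex.log p) / (π : ℝ) := by
      have hI := Complex.I_ne_zero
      have hpi : (π : ℂ) ≠ 0 := by exact_mod_cast Real.pi_ne_zero
      field_simp
      rw [Complex.I_sq]; ring
    rw [this, Complex.div_ofReal_im]
    simp only [Complex.neg_im, Complex.I_mul_im, Complex.log_re]
    have : Real.log ‖p‖ < 0 := Real.log_neg (norm_pos_iff.2 hp) hp1
    exact div_pos (by linarith) Real.pi_pos

lemma summable_sterm (p z : ℂ) (hp : p ≠ 0) (hp1 : ‖p‖ < 1) (hz : z ≠ 0) :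
    Summable (sterm p z) := by
  refine (summable_gauss p (-z / p) hp hp1 (div_ne_zero (neg_ne_zero.2 hz) hp)).congr fun n => ?_
  rw [sterm, mul_sub, zpow_sub₀ hp, div_zpow, ← neg_one_mul, mul_zpow, mul_one]
  ring

noncomputable def SS (p z : ℂ) : ℂ := ∑' m : ℤ, sterm p z m

noncomputable def TT (r z : ℂ) : ℂ := FP z r * FP (r / z) r

lemma triple (p : ℂ) (hp : p ≠ 0) (hp1 : ‖p‖ < 1) :
    ∃ c : ℂ, ∀ z : ℂ, z ≠ 0 → TT (p ^ 2) z = c * SS p z := by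
  set r := p ^ 2 with hr
  have hr1 : ‖r‖ < 1 := norm_pow_lt hp1 two_ne_zero
  have hD : Tendsto (DD r) atTop (𝓝 (FP r r)) := FP_tendsto r hr1
  have hF : FP r r ≠ 0 := FP_ne_zero hr1 hr1
  have hDi : Tendsto (fun n => (DD r n)⁻¹) atTop (𝓝 (FP r r)⁻¹) := hD.inv₀ hF
  have hD0 : ∀ n, DD r n ≠ 0 := by
    intro n
    refine Finset.prod_ne_zero_iff.2 fun i _ h0 => ?_
    have h2 := norm_pow_lt hr1 (Nat.succ_ne_zero i)
    rw [pow_succ', show r * r ^ i = 1 by linear_combination -h0] at h2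
    simp at h2
  obtain ⟨B1, hB1⟩ := hD.norm.bddAbove_range
  obtain ⟨B2, hB2⟩ := hDi.norm.bddAbove_range
  have hB1' : ∀ n, ‖DD r n‖ ≤ B1 := fun n => hB1 ⟨n, rfl⟩
  have hB2' : ∀ n, ‖(DD r n)⁻¹‖ ≤ B2 := fun n => hB2 ⟨n, rfl⟩
  have hB10 : 0 ≤ B1 := (norm_nonneg _).trans (hB1' 0)
  have hB20 : 0 ≤ B2 := (norm_nonneg _).trans (hB2' 0)
  have hg : ∀ a b : ℕ, gb r (a + b) a = DD r (a + b) * (DD r a)⁻¹ * (DD r b)⁻¹ := by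
    intro a b
    have := gb_DD r _ a b rfl
    have ha := hD0 a
    have hb := hD0 b
    field_simp
    linear_combination this
  have hg' : ∀ (N : ℕ) (m : ℤ), m ∈ Finset.Icc (-(N : ℤ)) N → gb r (N + N) (N + m).toNat =
      DD r (N + N) * (DD r (N + m).toNat)⁻¹ * (DD r (N - m).toNat)⁻¹ := by
    intro N m hm
    rw [Finset.mem_Icc] at hm
    have : N + N = (N + m).toNat + (N - m).toNat := by omega
    rw [this, hg]
  refine ⟨FP r r * (FP r r)⁻¹ * (FP r r)⁻¹, fun z hz => ?_⟩
  have h1 : Tendsto (fun N : ℕ => ∑' m : ℤ, if m ∈ Finset.Icc (-(N : ℤ)) N then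
      gb r (N + N) (N + m).toNat * sterm p z m else 0) atTop
      (𝓝 (∑' m : ℤ, FP r r * (FP r r)⁻¹ * (FP r r)⁻¹ * sterm p z m)) := by
    refine tendsto_tsum_of_dominated_convergence
      (bound := fun m => B1 * B2 * B2 * ‖sterm p z m‖)
      ((summable_sterm p z hp hp1 hz).norm.mul_left _) ?_ ?_
    · intro m
      have t1 : Tendsto (fun N : ℕ => N + N) atTop atTop :=
        tendsto_atTop_mono (fun n => Nat.le_add_left n n) tendsto_id
      have t2 : Tendsto (fun N : ℕ => ((N : ℤ) + m).toNat) atTop atTop := by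
        refine tendsto_atTop.2 fun b => ?_
        filter_upwards [eventually_ge_atTop (b + m.natAbs)] with N hN
        omega
      have t3 : Tendsto (fun N : ℕ => ((N : ℤ) - m).toNat) atTop atTop := by
        refine tendsto_atTop.2 fun b => ?_
        filter_upwards [eventually_ge_atTop (b + m.natAbs)] with N hN
        omega
      refine ((((hD.comp t1).mul (hDi.comp t2)).mul (hDi.comp t3)).mul_const
        (sterm p z m)).congr' ?_
      filter_upwards [eventually_ge_atTop (m.natAbs)] with N hN
      have hm : m ∈ Finset.Icc (-(N : ℤ)) N := by rw [Finset.mem_Icc]; omega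
      rw [if_pos hm, hg' N m hm]
      rfl
    · refine Eventually.of_forall fun N m => ?_
      split_ifs with hm
      · rw [hg' N m hm, norm_mul, norm_mul, norm_mul]
        gcongr
        · exact hB1' _
        · exact hB2' _
        · exact hB2' _
      · simp; positivity
  have h2 : Tendsto (fun N : ℕ => (∏ j ∈ Finset.range N, (1 - z * r ^ j)) *
      ∏ j ∈ Finset.range N, (1 - r / z * r ^ j)) atTop (𝓝 (TT r z)) :=
    (FP_tendsto z hr1).mul (FP_tendsto (r / z) hr1)
  rw [tsum_mul_left] at h1
  refine tendsto_nhds_unique h2 (h1.congr fun N => ?_)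
  rw [finite_triple p z hp hz N, tsum_eq_sum (s := Finset.Icc (-(N : ℤ)) N)]
  · exact Finset.sum_congr rfl fun m hm => by rw [if_pos hm]
  · intro m hm; rw [if_neg hm]

lemma sterm_even (p x y : ℂ) (hp : p ≠ 0) (hx : x ≠ 0) (hy : y ≠ 0) (a b : ℤ) :
    sterm p (x * y) (a + b) * sterm p (x / y) (a - b) =
      ((p ^ 2) ^ (a * a) * (x ^ 2 / p ^ 2) ^ a) * ((p ^ 2) ^ (b * b) * (y ^ 2) ^ b) := by
  have hs : (-1 : ℂ) ^ (a + b) * (-1) ^ (a - b) = 1 := by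
    rw [← zpow_add₀ (by norm_num), show a + b + (a - b) = 2 * a by ring, zpow_mul]
    norm_num
  obtain ⟨P, rfl⟩ : ∃ P, Complex.exp P = p := ⟨_, Complex.exp_log hp⟩
  obtain ⟨X, rfl⟩ : ∃ P, Complex.exp P = x := ⟨_, Complex.exp_log hx⟩
  obtain ⟨Y, rfl⟩ : ∃ P, Complex.exp P = y := ⟨_, Complex.exp_log hy⟩
  unfold sterm
  rw [show ∀ A B C D E F : ℂ, A * B * C * (D * E * F) = (A * D) * (B * C * (E * F)) by
    intros; ring, hs, one_mul]
  simp only [← Complex.exp_add, ← Complex.exp_sub, ← Complex.exp_int_mul, ← Complex.exp_nat_mul]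
  congr 1; push_cast; ring

lemma sterm_odd (p x y : ℂ) (hp : p ≠ 0) (hx : x ≠ 0) (hy : y ≠ 0) (a b : ℤ) :
    sterm p (x * y) (a + b + 1) * sterm p (x / y) (a - b) =
      ((p ^ 2) ^ (a * a) * (x ^ 2) ^ a) *
        ((p ^ 2) ^ ((b + 1) * (b + 1)) * (y ^ 2 / p ^ 2) ^ (b + 1)) * (-(x / y)) := by
  have hs : (-1 : ℂ) ^ (a + b + 1) * (-1) ^ (a - b) = -1 := by
    rw [← zpow_add₀ (by norm_num), show a + b + 1 + (a - b) = 2 * a + 1 by ring,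
      zpow_add₀ (by norm_num), zpow_mul]
    norm_num
  obtain ⟨P, rfl⟩ : ∃ P, Complex.exp P = p := ⟨_, Complex.exp_log hp⟩
  obtain ⟨X, rfl⟩ : ∃ P, Complex.exp P = x := ⟨_, Complex.exp_log hx⟩
  obtain ⟨Y, rfl⟩ : ∃ P, Complex.exp P = y := ⟨_, Complex.exp_log hy⟩
  unfold sterm
  rw [show ∀ A B C D E F : ℂ, A * B * C * (D * E * F) = (A * D) * (B * C * (E * F)) by
    intros; ring, hs, mul_neg, neg_one_mul]
  simp only [← Complex.exp_add, ← Complex.exp_sub, ← Complex.exp_int_mul, ← Complex.exp_nat_mul]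
  congr 2; push_cast; ring

def parMap : (ℤ × ℤ) ⊕ (ℤ × ℤ) → ℤ × ℤ
  | .inl (a, b) => (a + b, a - b)
  | .inr (a, b) => (a + b + 1, a - b)

lemma parMap_bij : Function.Bijective parMap := by
  constructor
  · rintro (⟨a, b⟩ | ⟨a, b⟩) (⟨c, d⟩ | ⟨c, d⟩) h <;> simp [parMap] at h ⊢ <;> omega
  · rintro ⟨m, n⟩
    rcases Int.even_or_odd' (m + n) with ⟨k, hk | hk⟩
    · exact ⟨.inl (k, m - k), by simp [parMap]; omega⟩
    · exact ⟨.inr (k, m - k - 1), by simp [parMap]; omega⟩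

lemma hasSum_par (F : ℤ × ℤ → ℂ) (a b : ℂ)
    (h1 : HasSum (fun z : ℤ × ℤ => F (z.1 + z.2, z.1 - z.2)) a)
    (h2 : HasSum (fun z : ℤ × ℤ => F (z.1 + z.2 + 1, z.1 - z.2)) b) : HasSum F (a + b) := by
  rw [← (Equiv.ofBijective parMap parMap_bij).hasSum_iff]
  exact HasSum.sum h1 h2

noncomputable def VV (p x : ℂ) : ℂ := ∑' a : ℤ, (p ^ 2) ^ (a * a) * (x ^ 2) ^ a
noncomputable def UU (p x : ℂ) : ℂ := ∑' a : ℤ, (p ^ 2) ^ (a * a) * (x ^ 2 / p ^ 2) ^ a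

set_option maxHeartbeats 2000000 in
lemma SS_mul (p x y : ℂ) (hp : p ≠ 0) (hp1 : ‖p‖ < 1) (hx : x ≠ 0) (hy : y ≠ 0) :
    SS p (x * y) * SS p (x / y) = UU p x * VV p y - x / y * (VV p x * UU p y) := by
  have hp2 : p ^ 2 ≠ 0 := pow_ne_zero 2 hp
  have hp21 := norm_pow_lt hp1 two_ne_zero
  have sV : ∀ x : ℂ, x ≠ 0 → Summable fun a : ℤ => (p ^ 2) ^ (a * a) * (x ^ 2) ^ a :=
    fun x hx => summable_gauss _ _ hp2 hp21 (pow_ne_zero 2 hx)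
  have sU : ∀ x : ℂ, x ≠ 0 → Summable fun a : ℤ => (p ^ 2) ^ (a * a) * (x ^ 2 / p ^ 2) ^ a :=
    fun x hx => summable_gauss _ _ hp2 hp21 (div_ne_zero (pow_ne_zero 2 hx) hp2)
  have s1 := summable_sterm p (x * y) hp hp1 (mul_ne_zero hx hy)
  have s2 := summable_sterm p (x / y) hp hp1 (div_ne_zero hx hy)
  rw [SS, SS, tsum_mul_tsum_of_summable_norm s1.norm s2.norm]
  have sU' : Summable fun b : ℤ => (p ^ 2) ^ ((b + 1) * (b + 1)) * (y ^ 2 / p ^ 2) ^ (b + 1) :=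
    (Equiv.addRight (1 : ℤ)).summable_iff.2 (sU y hy)
  have eU : ∑' b : ℤ, (p ^ 2) ^ ((b + 1) * (b + 1)) * (y ^ 2 / p ^ 2) ^ (b + 1) = UU p y :=
    (Equiv.addRight (1 : ℤ)).tsum_eq (fun a : ℤ => (p ^ 2) ^ (a * a) * (y ^ 2 / p ^ 2) ^ a)
  have h1 : HasSum (fun z : ℤ × ℤ => sterm p (x * y) (z.1 + z.2) * sterm p (x / y) (z.1 - z.2))
      (UU p x * VV p y) := by
    simp only [sterm_even p x y hp hx hy]
    rw [UU, VV, tsum_mul_tsum_of_summable_norm (sU x hx).norm (sV y hy).norm]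
    exact (summable_mul_of_summable_norm (sU x hx).norm (sV y hy).norm).hasSum
  have h2 : HasSum (fun z : ℤ × ℤ => sterm p (x * y) (z.1 + z.2 + 1) * sterm p (x / y) (z.1 - z.2))
      (VV p x * UU p y * (-(x / y))) := by
    simp only [sterm_odd p x y hp hx hy]
    refine HasSum.mul_right _ ?_
    rw [← eU, VV, tsum_mul_tsum_of_summable_norm (sV x hx).norm sU'.norm]
    exact (summable_mul_of_summable_norm (sV x hx).norm sU'.norm).hasSum
  have h3 := hasSum_par (fun z : ℤ × ℤ => sterm p (x * y) z.1 * sterm p (x / y) z.2) _ _ h1 h2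
  rw [h3.tsum_eq]
  ring

lemma TT_mul (p : ℂ) (hp : p ≠ 0) (hp1 : ‖p‖ < 1) : ∃ f g : ℂ → ℂ, ∀ x y : ℂ, x ≠ 0 → y ≠ 0 →
    TT (p ^ 2) (x * y) * TT (p ^ 2) (x / y) = x * (f x * g y - g x * f y) := by
  obtain ⟨c, hc⟩ := triple p hp hp1
  refine ⟨fun x => c * UU p x / x, fun x => c * VV p x, fun x y hx hy => ?_⟩
  rw [hc _ (mul_ne_zero hx hy), hc _ (div_ne_zero hx hy)]
  have := SS_mul p x y hp hp1 hx hy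
  field_simp at this ⊢
  linear_combination c ^ 2 * this

lemma TT_pow (q : ℂ) (hq : q ≠ 0) {k m : ℕ} (h : k ≤ m) :
    TT (q ^ m) (q ^ k) = FP (q ^ k) (q ^ m) * FP (q ^ (m - k)) (q ^ m) := by
  rw [TT, pow_sub₀ q hq h, div_eq_mul_inv]

/-- level 6 relation -/
lemma rel6 (q : ℂ) (hq : q ≠ 0) (hq1 : ‖q‖ < 1) :
    FP (q ^ 2) (q ^ 2) ^ 8 * FP (q ^ 3) (q ^ 3) ^ 4 * FP (q ^ 6) (q ^ 6) =
      FP q q * FP (q ^ 2) (q ^ 2) ^ 3 * FP (q ^ 3) (q ^ 3) ^ 9 +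
        q * FP q q ^ 4 * FP (q ^ 6) (q ^ 6) ^ 9 := by
  obtain ⟨f, g, h⟩ := TT_mul (q ^ 3) (pow_ne_zero _ hq) (norm_pow_lt hq1 (by norm_num))
  rw [← pow_mul] at h
  norm_num only at h
  have H : ∀ a b : ℕ, b ≤ a → TT (q ^ 6) (q ^ (a + b)) * TT (q ^ 6) (q ^ (a - b)) =
      q ^ a * (f (q ^ a) * g (q ^ b) - g (q ^ a) * f (q ^ b)) := by
    intro a b hab
    rw [← h _ _ (pow_ne_zero _ hq) (pow_ne_zero _ hq), pow_add, pow_sub₀ q hq hab, div_eq_mul_inv]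
  have hvx := H 3 2 (by norm_num)
  have huy := H 1 0 (by norm_num)
  have hvu := H 3 1 (by norm_num)
  have hxy := H 2 0 (by norm_num)
  have hvy := H 3 0 (by norm_num)
  have hxu := H 2 1 (by norm_num)
  norm_num only at hvx huy hvu hxy hvy hxu
  have t1 := TT_pow q hq (show 1 ≤ 6 by norm_num)
  have t2 := TT_pow q hq (show 2 ≤ 6 by norm_num)
  have t3 := TT_pow q hq (show 3 ≤ 6 by norm_num)
  have t4 := TT_pow q hq (show 4 ≤ 6 by norm_num)
  have t5 := TT_pow q hq (show 5 ≤ 6 by norm_num)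
  norm_num only at t1 t2 t3 t4 t5
  have t51 : TT (q ^ 6) (q ^ 5) = TT (q ^ 6) (q ^ 1) := by rw [t1, t5, mul_comm]
  have t42 : TT (q ^ 6) (q ^ 4) = TT (q ^ 6) (q ^ 2) := by rw [t2, t4, mul_comm]
  rw [t51] at hvx
  rw [t42] at hvu
  have e1 := FP_split q hq1 (show 6 ≠ 0 by norm_num)
  have e2 := FP_split (q ^ 2) (norm_pow_lt hq1 two_ne_zero) (show 3 ≠ 0 by norm_num)
  have e3 := FP_split (q ^ 3) (norm_pow_lt hq1 three_ne_zero) (show 2 ≠ 0 by norm_num)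
  simp only [Finset.prod_range_succ, Finset.prod_range_zero, one_mul, ← pow_mul, ← pow_add,
    ← pow_succ'] at e1 e2 e3
  norm_num only at e1 e2 e3
  have key : q * TT (q ^ 6) (q ^ 1) ^ 4 - TT (q ^ 6) (q ^ 2) ^ 4 +
      TT (q ^ 6) (q ^ 3) ^ 3 * TT (q ^ 6) (q ^ 1) = 0 := by
    generalize TT (q ^ 6) (q ^ 1) = T1 at *
    generalize TT (q ^ 6) (q ^ 2) = T2 at *
    generalize TT (q ^ 6) (q ^ 3) = T3 at *
    generalize f (q ^ 0) = f0 at *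
    generalize f (q ^ 1) = f1 at *
    generalize f (q ^ 2) = f2 at *
    generalize f (q ^ 3) = f3 at *
    generalize g (q ^ 0) = g0 at *
    generalize g (q ^ 1) = g1 at *
    generalize g (q ^ 2) = g2 at *
    generalize g (q ^ 3) = g3 at *
    clear t1 t2 t3 t4 t5 t51 t42 e1 e2 e3 H h
    have k1 := congrArg₂ (· * ·) hvx huy
    have k2 := congrArg₂ (· * ·) hvu hxy
    have k3 := congrArg₂ (· * ·) hvy hxu
    beta_reduce at k1 k2 k3
    linear_combination q * k1 - k2 + k3
  rw [t1, t2, t3] at key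
  rw [e1, e2, e3]
  simp only [pow_one] at *
  generalize FP q (q ^ 6) = a1 at *
  generalize FP (q ^ 2) (q ^ 6) = a2 at *
  generalize FP (q ^ 3) (q ^ 6) = a3 at *
  generalize FP (q ^ 4) (q ^ 6) = a4 at *
  generalize FP (q ^ 5) (q ^ 6) = a5 at *
  generalize FP (q ^ 6) (q ^ 6) = a6 at *
  clear t1 t2 t3 t4 t5 t51 t42 e1 e2 e3 H h hvx huy hvu hxy hvy hxu
  linear_combination (-(a2 * a4) ^ 4 * a3 ^ 4 * a6 ^ 13) * key

/-- two-dissection of `E3^3/E1`, uncleared -/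
lemma rel12 (q : ℂ) (hq : q ≠ 0) (hq1 : ‖q‖ < 1) :
    FP (q ^ 3) (q ^ 3) ^ 3 * FP (q ^ 2) (q ^ 2) ^ 2 * FP (q ^ 12) (q ^ 12) * FP (q ^ 4) (q ^ 4) =
      FP (q ^ 4) (q ^ 4) ^ 4 * FP (q ^ 6) (q ^ 6) ^ 2 * FP q q +
        q * FP (q ^ 12) (q ^ 12) ^ 4 * FP q q * FP (q ^ 2) (q ^ 2) ^ 2 := by
  obtain ⟨f, g, h⟩ := TT_mul (q ^ 6) (pow_ne_zero _ hq) (norm_pow_lt hq1 (by norm_num))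
  rw [← pow_mul] at h
  norm_num only at h
  have H : ∀ a b : ℕ, b ≤ a → TT (q ^ 12) (q ^ (a + b)) * TT (q ^ 12) (q ^ (a - b)) =
      q ^ a * (f (q ^ a) * g (q ^ b) - g (q ^ a) * f (q ^ b)) := by
    intro a b hab
    rw [← h _ _ (pow_ne_zero _ hq) (pow_ne_zero _ hq), pow_add, pow_sub₀ q hq hab, div_eq_mul_inv]
  have hux := H 4 3 (by norm_num)
  have hvy := H 2 0 (by norm_num)
  have huv := H 4 2 (by norm_num)
  have hxy := H 3 0 (by norm_num)
  have huy := H 4 0 (by norm_num)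
  have hxv := H 3 2 (by norm_num)
  norm_num only at hux hvy huv hxy huy hxv
  have t1 := TT_pow q hq (show 1 ≤ 12 by norm_num)
  have t2 := TT_pow q hq (show 2 ≤ 12 by norm_num)
  have t3 := TT_pow q hq (show 3 ≤ 12 by norm_num)
  have t4 := TT_pow q hq (show 4 ≤ 12 by norm_num)
  have t5 := TT_pow q hq (show 5 ≤ 12 by norm_num)
  have t6 := TT_pow q hq (show 6 ≤ 12 by norm_num)
  have t7 := TT_pow q hq (show 7 ≤ 12 by norm_num)
  norm_num only at t1 t2 t3 t4 t5 t6 t7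
  have t75 : TT (q ^ 12) (q ^ 7) = TT (q ^ 12) (q ^ 5) := by rw [t7, t5, mul_comm]
  rw [t75] at hux
  have e1 := FP_split q hq1 (show 12 ≠ 0 by norm_num)
  have e2 := FP_split (q ^ 2) (norm_pow_lt hq1 two_ne_zero) (show 6 ≠ 0 by norm_num)
  have e3 := FP_split (q ^ 3) (norm_pow_lt hq1 three_ne_zero) (show 4 ≠ 0 by norm_num)
  have e4 := FP_split (q ^ 4) (norm_pow_lt hq1 four_ne_zero) (show 3 ≠ 0 by norm_num)
  have e6 := FP_split (q ^ 6) (norm_pow_lt hq1 (show 6 ≠ 0 by norm_num)) (show 2 ≠ 0 by norm_num)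
  simp only [Finset.prod_range_succ, Finset.prod_range_zero, one_mul, ← pow_mul, ← pow_add,
    ← pow_succ'] at e1 e2 e3 e4 e6
  norm_num only at e1 e2 e3 e4 e6
  have key : q * TT (q ^ 12) (q ^ 5) * TT (q ^ 12) (q ^ 1) * TT (q ^ 12) (q ^ 2) ^ 2
      - TT (q ^ 12) (q ^ 6) * TT (q ^ 12) (q ^ 2) * TT (q ^ 12) (q ^ 3) ^ 2
      + TT (q ^ 12) (q ^ 4) ^ 2 * TT (q ^ 12) (q ^ 5) * TT (q ^ 12) (q ^ 1) = 0 := by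
    generalize TT (q ^ 12) (q ^ 1) = T1 at *
    generalize TT (q ^ 12) (q ^ 2) = T2 at *
    generalize TT (q ^ 12) (q ^ 3) = T3 at *
    generalize TT (q ^ 12) (q ^ 4) = T4 at *
    generalize TT (q ^ 12) (q ^ 5) = T5 at *
    generalize TT (q ^ 12) (q ^ 6) = T6 at *
    generalize f (q ^ 0) = f0 at *
    generalize f (q ^ 2) = f2 at *
    generalize f (q ^ 3) = f3 at *
    generalize f (q ^ 4) = f4 at *
    generalize g (q ^ 0) = g0 at *
    generalize g (q ^ 2) = g2 at *
    generalize g (q ^ 3) = g3 at *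
    generalize g (q ^ 4) = g4 at *
    clear t1 t2 t3 t4 t5 t6 t7 t75 e1 e2 e3 e4 e6 H h
    have k1 := congrArg₂ (· * ·) hux hvy
    have k2 := congrArg₂ (· * ·) huv hxy
    have k3 := congrArg₂ (· * ·) huy hxv
    beta_reduce at k1 k2 k3
    linear_combination q * k1 - k2 + k3
  rw [t1, t2, t3, t4, t5, t6] at key
  rw [e1, e2, e3, e4, e6]
  simp only [pow_one] at *
  generalize FP q (q ^ 12) = a1 at *
  generalize FP (q ^ 2) (q ^ 12) = a2 at *
  generalize FP (q ^ 3) (q ^ 12) = a3 at *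
  generalize FP (q ^ 4) (q ^ 12) = a4 at *
  generalize FP (q ^ 5) (q ^ 12) = a5 at *
  generalize FP (q ^ 6) (q ^ 12) = a6 at *
  generalize FP (q ^ 7) (q ^ 12) = a7 at *
  generalize FP (q ^ 8) (q ^ 12) = a8 at *
  generalize FP (q ^ 9) (q ^ 12) = a9 at *
  generalize FP (q ^ 10) (q ^ 12) = a10 at *
  generalize FP (q ^ 11) (q ^ 12) = a11 at *
  generalize FP (q ^ 12) (q ^ 12) = a12 at *
  clear t1 t2 t3 t4 t5 t6 t7 t75 e1 e2 e3 e4 e6 H h hux hvy huv hxy huy hxv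
  linear_combination (-(a4 * a8) ^ 3 * (a2 * a10) * (a3 * a9) * a6 ^ 3 * a12 ^ 7) * key

lemma FP_neg_q (q : ℂ) (hq1 : ‖q‖ < 1) :
    FP (-q) (-q) * FP q q * FP (q ^ 4) (q ^ 4) = FP (q ^ 2) (q ^ 2) ^ 3 := by
  have h2 := norm_pow_lt hq1 two_ne_zero
  have e1 := FP_split q hq1 two_ne_zero
  have e1' := FP_split (-q) (r := -q) (by simpa using hq1) two_ne_zero
  have e2 := FP_split (q ^ 2) h2 two_ne_zero
  have e3 := FP_neg_mul q h2
  simp only [Finset.prod_range_succ, Finset.prod_range_zero, one_mul, ← pow_mul, ← pow_add,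
    ← pow_succ', even_two, Even.neg_pow, mul_one, ← sq]
    at e1 e1' e2 e3
  norm_num only at e1 e1' e2 e3
  rw [neg_sq, pow_one] at e1'
  rw [pow_one] at e1
  rw [e1, e1']
  linear_combination FP (q ^ 2) (q ^ 2) ^ 2 * FP (q ^ 4) (q ^ 4) * e3 - FP (q ^ 2) (q ^ 2) ^ 2 * e2

lemma eta_eq_s16 (τ σ w : ℂ) (k : ℕ) (hk : k ≠ 0) (hτ : τ = k * σ) (hw : w = Complex.exp (π * Complex.I * σ / 12)) :
    eta τ = w ^ k * FP (Complex.exp (2 * π * Complex.I * σ) ^ k)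
      (Complex.exp (2 * π * Complex.I * σ) ^ k) := by
  rw [eta, FP, hw, hτ, ← Complex.exp_nat_mul]
  congr 1
  · congr 1; ring
  · refine tprod_congr fun n => ?_
    rw [← Complex.exp_nat_mul, ← Complex.exp_nat_mul, ← Complex.exp_add]
    congr 2; ring

lemma final_alg (w q e1 e2 e3 e4 e6 e12 d1 d3 : ℂ) (hw : w ^ 24 = q) (hw0 : w ≠ 0)
    (h1 : e1 ≠ 0) (h2 : e2 ≠ 0) (h3 : e3 ≠ 0) (h4 : e4 ≠ 0) (h6 : e6 ≠ 0) (h12 : e12 ≠ 0)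
    (hd1 : d1 * e1 * e4 = e2 ^ 3) (hd3 : d3 * e3 * e12 = e6 ^ 3)
    (ha : e3 ^ 3 * e2 ^ 2 * e12 * e4 = e4 ^ 4 * e6 ^ 2 * e1 + q * e12 ^ 4 * e1 * e2 ^ 2)
    (hb : d3 ^ 3 * e2 ^ 2 * e12 * e4 = e4 ^ 4 * e6 ^ 2 * d1 + (-q) * e12 ^ 4 * d1 * e2 ^ 2)
    (hc : e4 ^ 8 * e6 ^ 4 * e12 = e2 * e4 ^ 3 * e6 ^ 9 + q ^ 2 * e2 ^ 4 * e12 ^ 9) :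
    ((w ^ 3 * e3) ^ 9 * (w ^ 2 * e2) ^ 3) / ((w ^ 1 * e1) ^ 3 * (w ^ 6 * e6) ^ 9)
      - ((w ^ 1 * e1) ^ 3 * (w ^ 4 * e4) ^ 3 * (w ^ 6 * e6) ^ 18) /
          ((w ^ 2 * e2) ^ 6 * (w ^ 3 * e3) ^ 9 * (w ^ 12 * e12) ^ 9)
      - 8 * ((w ^ 2 * e2) ^ 3 * (w ^ 12 * e12) ^ 9) / ((w ^ 4 * e4) ^ 3 * (w ^ 6 * e6) ^ 9) = 6 := by
  have hq0 : q ≠ 0 := hw ▸ pow_ne_zero _ hw0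
  have hd1' : d1 ≠ 0 := by
    rintro rfl; apply pow_ne_zero 3 h2; rw [← hd1]; ring
  have hd3' : d3 ≠ 0 := by
    rintro rfl; apply pow_ne_zero 3 h6; rw [← hd3]; ring
  obtain ⟨A, hA⟩ : ∃ A, A = e4 ^ 3 * e6 ^ 2 / (e2 ^ 2 * e12) := ⟨_, rfl⟩
  obtain ⟨B, hB⟩ : ∃ B, B = e12 ^ 3 / e4 := ⟨_, rfl⟩
  have hX : e3 ^ 3 / e1 = A + q * B := by
    rw [hA, hB]; field_simp; linear_combination ha
  have hY : d3 ^ 3 / d1 = A - q * B := by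
    rw [hA, hB]; field_simp; linear_combination hb
  have hAB : A ^ 2 * B = e6 ^ 9 / e2 ^ 3 + q ^ 2 * e12 ^ 9 / e4 ^ 3 := by
    rw [hA, hB]; field_simp; linear_combination hc
  have hB3 : B ^ 3 = e12 ^ 9 / e4 ^ 3 := by rw [hB]; field_simp
  have T1 : ((w ^ 3 * e3) ^ 9 * (w ^ 2 * e2) ^ 3) / ((w ^ 1 * e1) ^ 3 * (w ^ 6 * e6) ^ 9) =
      e2 ^ 3 / (e6 ^ 9 * q) * (e3 ^ 3 / e1) ^ 3 := by
    rw [← hw]; field_simp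
  have T2 : ((w ^ 1 * e1) ^ 3 * (w ^ 4 * e4) ^ 3 * (w ^ 6 * e6) ^ 18) /
          ((w ^ 2 * e2) ^ 6 * (w ^ 3 * e3) ^ 9 * (w ^ 12 * e12) ^ 9) =
      e2 ^ 3 / (e6 ^ 9 * q) * (d3 ^ 3 / d1) ^ 3 := by
    have x1 : d1 = e2 ^ 3 / (e1 * e4) := by field_simp; linear_combination hd1
    have x3 : d3 = e6 ^ 3 / (e3 * e12) := by field_simp; linear_combination hd3
    rw [← hw, x1, x3]; field_simp
  have T3 : 8 * ((w ^ 2 * e2) ^ 3 * (w ^ 12 * e12) ^ 9) / ((w ^ 4 * e4) ^ 3 * (w ^ 6 * e6) ^ 9) =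
      8 * q ^ 2 * e2 ^ 3 / e6 ^ 9 * (e12 ^ 9 / e4 ^ 3) := by
    rw [← hw]; field_simp
  rw [T1, T2, T3, hX, hY, ← hB3]
  have : e2 ^ 3 / (e6 ^ 9 * q) * (A + q * B) ^ 3 - e2 ^ 3 / (e6 ^ 9 * q) * (A - q * B) ^ 3 =
      e2 ^ 3 / e6 ^ 9 * (6 * (A ^ 2 * B) + 2 * q ^ 2 * B ^ 3) := by
    field_simp; ring
  rw [this, hAB, mul_div_assoc, ← hB3]
  field_simp
  ring

theorem statement16 (τ : ℂ) (hτ : 0 < τ.im) :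
    (eta (3 * τ / 2) ^ 9 * eta τ ^ 3) / (eta (τ / 2) ^ 3 * eta (3 * τ) ^ 9)
      - (eta (τ / 2) ^ 3 * eta (2 * τ) ^ 3 * eta (3 * τ) ^ 18) /
          (eta τ ^ 6 * eta (3 * τ / 2) ^ 9 * eta (6 * τ) ^ 9)
      - 8 * (eta τ ^ 3 * eta (6 * τ) ^ 9) / (eta (2 * τ) ^ 3 * eta (3 * τ) ^ 9) = 6 := by
  obtain ⟨w, hw⟩ : ∃ w, w = Complex.exp (π * Complex.I * (τ / 2) / 12) := ⟨_, rfl⟩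
  rw [eta_eq_s16 (3 * τ / 2) (τ / 2) w 3 (by norm_num) (by push_cast; ring) hw,
    eta_eq_s16 (3 * τ) (τ / 2) w 6 (by norm_num) (by push_cast; ring) hw,
    eta_eq_s16 (6 * τ) (τ / 2) w 12 (by norm_num) (by push_cast; ring) hw,
    eta_eq_s16 (2 * τ) (τ / 2) w 4 (by norm_num) (by push_cast; ring) hw,
    eta_eq_s16 (τ / 2) (τ / 2) w 1 (by norm_num) (by push_cast; ring) hw,
    eta_eq_s16 τ (τ / 2) w 2 (by norm_num) (by push_cast; ring) hw]
  have hw0 : w ≠ 0 := hw ▸ Complex.exp_ne_zero _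
  have hwq : w ^ 24 = Complex.exp (2 * π * Complex.I * (τ / 2)) := by
    rw [hw, ← Complex.exp_nat_mul]; congr 1; push_cast; ring
  have hq1 : ‖Complex.exp (2 * π * Complex.I * (τ / 2))‖ < 1 := by
    rw [Complex.norm_exp, Real.exp_lt_one_iff]
    have : 2 * π * Complex.I * (τ / 2) = (π : ℝ) * (Complex.I * τ) := by ring
    rw [this, Complex.re_ofReal_mul, Complex.I_mul_re]
    nlinarith [Real.pi_pos, mul_pos Real.pi_pos hτ]
  have hq0 : Complex.exp (2 * π * Complex.I * (τ / 2)) ≠ 0 := Complex.exp_ne_zero _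
  generalize Complex.exp (2 * π * Complex.I * (τ / 2)) = q at *
  have hne : ∀ k : ℕ, k ≠ 0 → FP (q ^ k) (q ^ k) ≠ 0 := fun k hk =>
    FP_ne_zero (norm_pow_lt hq1 hk) (norm_pow_lt hq1 hk)
  have hm := rel12 (-q) (neg_ne_zero.2 hq0) (by simpa using hq1)
  have ev : ∀ k : ℕ, Even k → (-q) ^ k = q ^ k := fun k hk => hk.neg_pow q
  rw [ev 2 (by decide), ev 4 (by decide), ev 6 (by decide), ev 12 (by decide)] at hm
  have o3 : (-q) ^ 3 = -q ^ 3 := by ring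
  rw [o3] at hm
  have n3 := FP_neg_q (q ^ 3) (norm_pow_lt hq1 three_ne_zero)
  have r6 := rel6 (q ^ 2) (pow_ne_zero 2 hq0) (norm_pow_lt hq1 two_ne_zero)
  simp only [← pow_mul] at n3 r6
  norm_num only at n3 r6
  refine final_alg w q (FP (q ^ 1) (q ^ 1)) _ _ _ _ _ (FP (-q) (-q)) (FP (-q ^ 3) (-q ^ 3)) hwq hw0
    (hne 1 (by norm_num)) (hne 2 (by norm_num)) (hne 3 (by norm_num)) (hne 4 (by norm_num))
    (hne 6 (by norm_num)) (hne 12 (by norm_num)) ?_ ?_ ?_ ?_ ?_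
  · simpa using FP_neg_q q hq1
  · exact n3
  · simpa using rel12 q hq0 hq1
  · exact hm
  · linear_combination r6
end
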